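/- arXiv:2401.02005 — 4 statements merged into one kernel-verified Lean document; each statement's English description precedes it below -/
import Mathlib

section
/- For every integer d and every integer n ≥ 2, the integer d(d−1) divides ∑_{m ∣ n} μ(n/m)·(d^m + 1), where the sum ranges over the positive divisors m of n. -/
open Finset

/-- For every integer `d` and every `n ≥ 2`, the integer `d(d-1)`
divides `d_n := ∑_{m ∣ n} μ(n/m) (d^m + 1)`. -/
theorem stmt3 (d : ℤ) (n : ℕ) (hn : 2 ≤ n) :
    d * (d - 1) ∣ ∑ m ∈ n.divisors, ArithmeticFunction.moebius (n / m) * (d ^ m + 1) := by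
  have h0 : ∑ m ∈ n.divisors, ArithmeticFunction.moebius (n / m) = 0 := by
    rw [Nat.sum_div_divisors n (fun k => ArithmeticFunction.moebius k),
      ← ArithmeticFunction.coe_zeta_mul_apply, ArithmeticFunction.coe_zeta_mul_moebius,
      ArithmeticFunction.one_apply_ne (by omega)]
  have h1 : ∑ m ∈ n.divisors, ArithmeticFunction.moebius (n / m) * (d ^ m + 1)
      = ∑ m ∈ n.divisors, ArithmeticFunction.moebius (n / m) * (d ^ m - d) := by
    have : ∑ m ∈ n.divisors, ArithmeticFunction.moebius (n / m) * (d + 1) = 0 := by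
      rw [← Finset.sum_mul, h0, zero_mul]
    rw [← sub_eq_zero, ← Finset.sum_sub_distrib, ← this]
    exact Finset.sum_congr rfl fun m _ => by ring
  rw [h1]
  refine Finset.dvd_sum fun m hm => Dvd.dvd.mul_left ?_ _
  obtain ⟨k, rfl⟩ := Nat.exists_eq_succ_of_ne_zero (Nat.pos_of_mem_divisors hm).ne'
  have h2 : d ^ (k + 1) - d = d * (d ^ k - 1) := by ring
  rw [Nat.succ_eq_add_one, h2]
  exact mul_dvd_mul_left d (by simpa using sub_dvd_pow_sub_pow d 1 k)
end

section
/- Assume |Res F| = 1, i.e. there exist A₁,…,A_d ∈ ℂ² ∖ {(0,0)} with F₀(Z) = ∏_{i=1}^d (Z ∧ A_i) for all Z ∈ ℂ² and ∏_{i=1}^d |F₁(A_i)| = 1. Fix n ≥ 1 and suppose that for every divisor m of n there are points Z^{(m)}_1,…,Z^{(m)}_{d_m} ∈ ℂ² ∖ {(0,0)} such that for every divisor m of n and all Z ∈ ℂ², F^m(Z) ∧ Z = ∏_{k ∣ m} ∏_{j=1}^{d_k} (Z ∧ Z^{(k)}_j). Then ∑_{j=1}^{d_n} G^F(Z^{(n)}_j)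 = 0. -/
open Filter Finset MvPolynomial

/-- Evaluation of a bivariate polynomial at a point of `ℂ²`. -/
noncomputable def ev (P : MvPolynomial (Fin 2) ℂ) (Z : ℂ × ℂ) : ℂ :=
  MvPolynomial.eval ![Z.1, Z.2] P

/-- The self-map of `ℂ²` determined by the pair `F = (F₀, F₁)`. -/
noncomputable def Fmap (F₀ F₁ : MvPolynomial (Fin 2) ℂ) (Z : ℂ × ℂ) : ℂ × ℂ :=
  (ev F₀ Z, ev F₁ Z)

/-- The Euclidean norm on `ℂ²`. -/
noncomputable def enorm2 (Z : ℂ × ℂ) : ℝ := Real.sqrt (‖Z.1‖ ^ 2 + ‖Z.2‖ ^ 2)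

/-- The wedge `Z ∧ W = Z₀W₁ − Z₁W₀` on `ℂ²`. -/
def wedge (Z W : ℂ × ℂ) : ℂ := Z.1 * W.2 - Z.2 * W.1

/-- `d_m := ∑_{k ∣ m} μ(m/k)(d^k + 1)`, the number of periodic points of formally exact
period `m` of a degree-`d` rational map. -/
def dyndeg (d m : ℕ) : ℤ :=
  ∑ k ∈ m.divisors, ArithmeticFunction.moebius (m / k) * ((d : ℤ) ^ k + 1)

namespace Dyn10

lemma wedge_self (Z : ℂ × ℂ) : wedge Z Z = 0 := by simp only [wedge]; ring

lemma wedge_smul_left (c : ℂ) (Z W : ℂ × ℂ) : wedge (c • Z) W = c * wedge Z W := by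
  simp only [wedge, Prod.smul_fst, Prod.smul_snd, smul_eq_mul]; ring

lemma wedge_smul_right (c : ℂ) (Z W : ℂ × ℂ) : wedge Z (c • W) = c * wedge Z W := by
  simp only [wedge, Prod.smul_fst, Prod.smul_snd, smul_eq_mul]; ring

lemma norm_wedge_comm (Z W : ℂ × ℂ) : ‖wedge Z W‖ = ‖wedge W Z‖ := by
  rw [← norm_neg]; congr 1; simp only [wedge]; ring

lemma wedge_eq_zero {V W : ℂ × ℂ} (hV : V ≠ 0) (hW : W ≠ 0) (h : wedge V W = 0) :
    ∃ c : ℂ, c ≠ 0 ∧ V = c • W := by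
  have key : ∃ c : ℂ, V = c • W := by
    simp only [wedge] at h
    by_cases h1 : W.1 = 0
    · have h2 : W.2 ≠ 0 := fun h2 => hW (Prod.ext h1 h2)
      refine ⟨V.2 / W.2, Prod.ext ?_ ?_⟩
      · have : V.1 * W.2 = 0 := by rw [h1] at h; simpa using h
        have : V.1 = 0 := by simpa [h2] using this
        simp [h1, this]
      · simp [h2]
    · refine ⟨V.1 / W.1, Prod.ext ?_ ?_⟩
      · simp [h1]
      · simp only [Prod.smul_snd, smul_eq_mul]
        field_simp
        linear_combination -h
  obtain ⟨c, hc⟩ := key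
  refine ⟨c, ?_, hc⟩
  rintro rfl
  exact hV (by simpa using hc)

/-- `Φ ∧ W` factors with the points `B i`. -/
def IsFac (Φ : ℂ × ℂ → ℂ × ℂ) (W : ℂ × ℂ) {ι : Type} [Fintype ι] (B : ι → ℂ × ℂ) : Prop :=
  (∀ i, B i ≠ 0) ∧ ∀ Z, wedge (Φ Z) W = ∏ i, wedge Z (B i)

lemma IsFac.exists_c {Φ : ℂ × ℂ → ℂ × ℂ} {W : ℂ × ℂ} {ι : Type} [Fintype ι] {B : ι → ℂ × ℂ}
    (h : IsFac Φ W B) (hW : W ≠ 0) (hΦ : ∀ Z, Z ≠ 0 → Φ Z ≠ 0) :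
    ∃ c : ι → ℂ, (∀ i, c i ≠ 0) ∧ ∀ i, Φ (B i) = c i • W := by
  have : ∀ i, ∃ c : ℂ, c ≠ 0 ∧ Φ (B i) = c • W := fun i => by
    apply wedge_eq_zero (hΦ _ (h.1 i)) hW
    rw [h.2]
    exact Finset.prod_eq_zero (Finset.mem_univ i) (wedge_self _)
  choose c hc using this
  exact ⟨c, fun i => (hc i).1, fun i => (hc i).2⟩

lemma sumlog {Φ : ℂ × ℂ → ℂ × ℂ} {G : ℂ × ℂ → ℝ} {D : ℕ}
    (hGs : ∀ (c : ℂ) Z, c ≠ 0 → Z ≠ 0 → G (c • Z) = Real.log ‖c‖ + G Z)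
    (hGΦ : ∀ Z, Z ≠ 0 → G (Φ Z) = D * G Z)
    {W : ℂ × ℂ} (hW : W ≠ 0) {ι : Type} [Fintype ι] {B : ι → ℂ × ℂ} (hB : ∀ i, B i ≠ 0)
    (hcard : Fintype.card ι = D) {c : ι → ℂ} (hc0 : ∀ i, c i ≠ 0)
    (hc : ∀ i, Φ (B i) = c i • W) :
    Real.log (∏ i, ‖c i‖) = D * (∑ i, G (B i) - G W) := by
  rw [Real.log_prod (fun i _ => norm_ne_zero_iff.2 (hc0 i))]
  have : ∀ i, Real.log ‖c i‖ = D * G (B i) - G W := fun i => by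
    rw [← hGΦ _ (hB i), hc i, hGs _ _ (hc0 i) hW]; ring
  simp_rw [this]
  rw [Finset.sum_sub_distrib, ← Finset.mul_sum]
  simp [hcard]; ring

lemma swap {Φ : ℂ × ℂ → ℂ × ℂ} {D : ℕ}
    {W W' : ℂ × ℂ} {ι κ : Type} [Fintype ι] [Fintype κ] {B : ι → ℂ × ℂ} {B' : κ → ℂ × ℂ}
    (hι : Fintype.card ι = D) (hκ : Fintype.card κ = D)
    (h : IsFac Φ W B) (h' : IsFac Φ W' B') {c : ι → ℂ} {c' : κ → ℂ}
    (hc : ∀ i, Φ (B i) = c i • W) (hc' : ∀ i, Φ (B' i) = c' i • W')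
    (hWW : wedge W W' ≠ 0) : ∏ i, ‖c i‖ = ∏ i, ‖c' i‖ := by
  have e1 : ∏ i, ∏ k, ‖wedge (B i) (B' k)‖ = (∏ i, ‖c i‖) * ‖wedge W W'‖ ^ D := by
    have : ∀ i, ∏ k, ‖wedge (B i) (B' k)‖ = ‖c i‖ * ‖wedge W W'‖ := fun i => by
      rw [← norm_prod, ← h'.2, hc, wedge_smul_left, norm_mul]
    simp_rw [this, Finset.prod_mul_distrib]
    simp [hι]
  have e2 : ∏ i, ∏ k, ‖wedge (B i) (B' k)‖ = (∏ i, ‖c' i‖) * ‖wedge W W'‖ ^ D := by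
    rw [Finset.prod_comm]
    have : ∀ k, ∏ i, ‖wedge (B i) (B' k)‖ = ‖c' k‖ * ‖wedge W W'‖ := fun k => by
      simp_rw [fun i => norm_wedge_comm (B i) (B' k)]
      rw [← norm_prod, ← h.2, hc', wedge_smul_left, norm_mul, norm_wedge_comm W' W]
    simp_rw [this, Finset.prod_mul_distrib]
    simp [hκ]
  exact mul_right_cancel₀ (pow_ne_zero D (norm_ne_zero_iff.2 hWW)) (e1.symm.trans e2)

/-- transfer of the mass identity -/
lemma transfer {Φ : ℂ × ℂ → ℂ × ℂ} {G : ℂ × ℂ → ℝ} {D : ℕ} (hD : D ≠ 0)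
    (hGs : ∀ (c : ℂ) Z, c ≠ 0 → Z ≠ 0 → G (c • Z) = Real.log ‖c‖ + G Z)
    (hGΦ : ∀ Z, Z ≠ 0 → G (Φ Z) = D * G Z) (hΦ : ∀ Z, Z ≠ 0 → Φ Z ≠ 0)
    {W W' : ℂ × ℂ} (hW : W ≠ 0) (hW' : W' ≠ 0)
    {ι κ : Type} [Fintype ι] [Fintype κ] {B : ι → ℂ × ℂ} {B' : κ → ℂ × ℂ}
    (hι : Fintype.card ι = D) (hκ : Fintype.card κ = D)
    (h : IsFac Φ W B) (h' : IsFac Φ W' B') (hWW : wedge W W' ≠ 0)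
    (hsum : ∑ i, G (B i) = G W) : ∑ i, G (B' i) = G W' := by
  obtain ⟨c, hc0, hc⟩ := h.exists_c hW hΦ
  obtain ⟨c', hc0', hc'⟩ := h'.exists_c hW' hΦ
  have e := swap hι hκ h h' hc hc' hWW
  have l1 := sumlog hGs hGΦ hW h.1 hι hc0 hc
  have l2 := sumlog hGs hGΦ hW' h'.1 hκ hc0' hc'
  rw [e, l2, hsum] at l1
  have hD' : (D : ℝ) ≠ 0 := by exact_mod_cast hD
  have : (∑ i, G (B' i)) - G W' = 0 := by simpa [hD'] using l1
  linarith

/-- the periodic points -/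
lemma final {Φ : ℂ × ℂ → ℂ × ℂ} {G : ℂ × ℂ → ℝ} {D : ℕ} (hD : 2 ≤ D)
    (hGs : ∀ (c : ℂ) Z, c ≠ 0 → Z ≠ 0 → G (c • Z) = Real.log ‖c‖ + G Z)
    (hGΦ : ∀ Z, Z ≠ 0 → G (Φ Z) = D * G Z) (hΦ : ∀ Z, Z ≠ 0 → Φ Z ≠ 0)
    (hfac : ∀ W : ℂ × ℂ, W ≠ 0 → ∃ (ι : Type) (_ : Fintype ι) (B : ι → ℂ × ℂ),
      Fintype.card ι = D ∧ IsFac Φ W B ∧ ∑ i, G (B i) = G W)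
    {τ : Type} [Fintype τ] (P : τ → ℂ × ℂ) (hP : ∀ j, P j ≠ 0)
    (hH : ∀ Z, wedge (Φ Z) Z = ∏ j, wedge Z (P j)) : ∑ j, G (P j) = 0 := by
  obtain ⟨W, hW0, hW⟩ : ∃ W : ℂ × ℂ, W ≠ 0 ∧ ∀ j, wedge W (P j) ≠ 0 := by
    have hfin : (⋃ j, {x : ℂ | wedge (1, x) (P j) = 0}).Finite := by
      apply Set.finite_iUnion
      intro j
      apply Set.Subsingleton.finite
      intro x hx y hy
      simp only [wedge, Set.mem_ofPred_eq, one_mul] at hx hy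
      have h1 : (P j).1 ≠ 0 := fun h1 => hP j (Prod.ext h1 (by simpa [h1] using hx))
      exact mul_right_cancel₀ h1 (by linear_combination hy - hx)
    obtain ⟨x, hx⟩ := hfin.infinite_compl.nonempty
    refine ⟨(1, x), by simp, ?_⟩
    simpa using hx
  obtain ⟨ι, _, B, hι, hB, hs⟩ := hfac W hW0
  obtain ⟨c, hc0, hc⟩ := hB.exists_c hW0 hΦ
  have l1 := sumlog hGs hGΦ hW0 hB.1 hι hc0 hc
  have hc1 : ∀ j, ∃ c : ℂ, c ≠ 0 ∧ Φ (P j) = c • P j := fun j => by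
    apply wedge_eq_zero (hΦ _ (hP j)) (hP j)
    rw [hH]
    exact Finset.prod_eq_zero (Finset.mem_univ j) (wedge_self _)
  choose lam hl using hc1
  have hHW : ‖wedge (Φ W) W‖ ≠ 0 := by
    rw [hH, norm_ne_zero_iff]
    exact Finset.prod_ne_zero_iff.2 fun j _ => hW j
  have e1 : ∏ j, ∏ i, ‖wedge (P j) (B i)‖ = (∏ j, ‖lam j‖) * ‖wedge (Φ W) W‖ := by
    rw [hH, norm_prod, ← Finset.prod_mul_distrib]
    refine Finset.prod_congr rfl fun j _ => ?_
    rw [← norm_prod, ← hB.2, (hl j).2, wedge_smul_left, norm_mul, norm_wedge_comm W]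
  have e2 : ∏ j, ∏ i, ‖wedge (P j) (B i)‖ = (∏ i, ‖c i‖) * ‖wedge (Φ W) W‖ := by
    rw [Finset.prod_comm, hB.2, norm_prod, ← Finset.prod_mul_distrib]
    refine Finset.prod_congr rfl fun i _ => ?_
    simp_rw [fun j => norm_wedge_comm (P j) (B i)]
    rw [← norm_prod, ← hH, hc, wedge_smul_left, norm_mul]
  have e := mul_right_cancel₀ hHW (e1.symm.trans e2)
  rw [← e, hs, sub_self, mul_zero, Real.log_prod (fun j _ => norm_ne_zero_iff.2 (hl j).1)] at l1
  have : ∀ j, Real.log ‖lam j‖ = ((D : ℝ) - 1) * G (P j) := fun j => by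
    have h1 := hGs _ _ (hl j).1 (hP j)
    rw [← (hl j).2, hGΦ _ (hP j)] at h1
    linarith
  simp_rw [this, ← Finset.mul_sum] at l1
  have hD' : (2 : ℝ) ≤ D := by exact_mod_cast hD
  have hD1 : (D : ℝ) - 1 ≠ 0 := by linarith
  simpa [hD1] using l1

lemma ev_smul {d : ℕ} {P : MvPolynomial (Fin 2) ℂ} (hP : P.IsHomogeneous d) (c : ℂ) (Z : ℂ × ℂ) :
    ev P (c • Z) = c ^ d * ev P Z := by
  unfold ev
  rw [MvPolynomial.eval_eq', MvPolynomial.eval_eq', Finset.mul_sum]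
  refine Finset.sum_congr rfl fun m hm => ?_
  have hw := hP (MvPolynomial.mem_support_iff.1 hm)
  have hw' : m 0 + m 1 = d := by
    rw [← hw, Finsupp.weight_apply, Finsupp.sum_fintype _ _ (by simp)]
    simp
  simp only [Fin.prod_univ_two, ← hw', Prod.smul_fst, Prod.smul_snd, smul_eq_mul,
    Matrix.cons_val_zero, Matrix.cons_val_one]
  ring

lemma ev_cont (P : MvPolynomial (Fin 2) ℂ) : Continuous (ev P) := by
  unfold ev
  apply (MvPolynomial.continuous_eval P).comp
  apply continuous_pi
  intro i
  fin_cases i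
  · exact continuous_fst
  · exact continuous_snd

lemma ext_dense {f g : ℂ × ℂ → ℂ} (hf : Continuous f) (hg : Continuous g)
    (h : ∀ x y : ℂ, x ≠ 0 → f (x, y) = g (x, y)) (Z : ℂ × ℂ) : f Z = g Z := by
  have hd : Dense (({0}ᶜ : Set ℂ) ×ˢ (Set.univ : Set ℂ)) :=
    (dense_compl_singleton 0).prod dense_univ
  refine congrFun (Continuous.ext_on hd hf hg ?_) Z
  rintro ⟨x, y⟩ hxy
  exact h x y (by simpa using hxy)

lemma wedge_cont (B : ℂ × ℂ) : Continuous (fun Z => wedge Z B) := by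
  unfold wedge; fun_prop

lemma factor {d : ℕ} (hd : d ≠ 0) {P : MvPolynomial (Fin 2) ℂ} (hP : P.IsHomogeneous d)
    (hne : ∃ Z, ev P Z ≠ 0) : ∃ (ι : Type) (_ : Fintype ι) (B : ι → ℂ × ℂ),
      Fintype.card ι = d ∧ (∀ i, B i ≠ 0) ∧ ∀ Z, ev P Z = ∏ i, wedge Z (B i) := by
  set p : Polynomial ℂ := MvPolynomial.aeval ![1, Polynomial.X] P with hp
  have hpe : ∀ r, p.eval r = ev P (1, r) := by
    intro r
    have : (Polynomial.aeval r) p = MvPolynomial.aeval ![1, r] P := by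
      rw [hp, ← AlgHom.comp_apply, MvPolynomial.comp_aeval]
      congr 2
      funext i
      fin_cases i <;> simp
    rw [Polynomial.coe_aeval_eq_eval, MvPolynomial.aeval_eq_eval] at this
    exact this
  have hdeg : p.natDegree ≤ d := by
    have := MvPolynomial.aeval_natDegree_le P (m := d) hP.totalDegree_le ![1, Polynomial.X] (n := 1)
      (by intro i; fin_cases i <;> simp)
    simpa using this
  have hhom : ∀ x y : ℂ, x ≠ 0 → ev P (x, y) = x ^ d * p.eval (y / x) := by
    intro x y hx
    rw [hpe, ← ev_smul hP]
    congr 1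
    ext <;> simp [mul_div_cancel₀, hx]
  have hp0 : p ≠ 0 := by
    intro h0
    obtain ⟨Z, hZ⟩ := hne
    apply hZ
    exact ext_dense (ev_cont P) (g := fun _ => 0) continuous_const
      (fun x y hx => by rw [hhom x y hx, h0]; simp) Z
  have hsplit := (IsAlgClosed.splits p).eq_prod_roots
  have hcard : Multiset.card p.roots = p.natDegree := (IsAlgClosed.splits p).natDegree_eq_card_roots.symm
  obtain ⟨α, hα⟩ := IsAlgClosed.exists_pow_nat_eq p.leadingCoeff (Nat.pos_of_ne_zero hd)
  have hα0 : α ≠ 0 := by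
    rintro rfl
    rw [zero_pow hd] at hα
    exact hp0 (Polynomial.leadingCoeff_eq_zero.1 hα.symm)
  set M : Multiset (ℂ × ℂ) := p.roots.map (fun r => (-1, -r)) +
    Multiset.replicate (d - p.natDegree) ((0, 1) : ℂ × ℂ) with hM
  have hMc : M.toList.length = d := by
    simp [hM, hcard]; omega
  have hM0 : ∀ B ∈ M, B ≠ 0 := by
    intro B hB
    rw [hM, Multiset.mem_add] at hB
    rcases hB with hB | hB
    · obtain ⟨r, _, rfl⟩ := Multiset.mem_map.1 hB
      simp
    · rw [Multiset.eq_of_mem_replicate hB]; simp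
  refine ⟨Fin M.toList.length, inferInstance, fun i => α • M.toList[i], by simp [hMc], ?_, ?_⟩
  · intro i
    exact smul_ne_zero hα0 (hM0 _ (Multiset.mem_toList.1 (List.getElem_mem _)))
  · apply ext_dense (ev_cont P) (continuous_finsetProd _ fun i _ => wedge_cont _)
    intro x y hx
    simp_rw [wedge_smul_right]
    have h0 : ∏ _i : Fin M.toList.length, α = p.leadingCoeff := by
      rw [Finset.prod_const, Finset.card_univ, Fintype.card_fin, hMc, hα]
    rw [Finset.prod_mul_distrib, h0]
    have h1 : ∏ i : Fin M.toList.length, wedge (x, y) (M.toList[i]) =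
        (M.map (fun B => wedge (x, y) B)).prod := by
      conv_rhs => rw [← Multiset.coe_toList M, Multiset.map_coe, Multiset.prod_coe]
      exact Fin.prod_univ_fun_getElem M.toList (fun B => wedge (x, y) B)
    rw [h1, hM, Multiset.map_add, Multiset.prod_add, Multiset.map_map, Multiset.map_replicate,
      Multiset.prod_replicate, hhom x y hx]
    have h2 : p.eval (y / x) = p.leadingCoeff * (p.roots.map (fun r => y / x - r)).prod := by
      conv_lhs => rw [hsplit]
      rw [Polynomial.eval_mul, Polynomial.eval_C, Polynomial.eval_multiset_prod, Multiset.map_map]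
      simp
    have h3 : (p.roots.map ((fun B => wedge (x, y) B) ∘ fun r => (-1, -r))).prod =
        x ^ p.natDegree * (p.roots.map (fun r => y / x - r)).prod := by
      rw [← hcard, ← Multiset.prod_replicate, ← Multiset.map_const', ← Multiset.prod_map_mul]
      congr 1
      refine Multiset.map_congr rfl fun r _ => ?_
      simp only [Function.comp, wedge]
      field_simp
      ring
    rw [h2, h3]
    simp only [wedge]
    have : x ^ d = x ^ p.natDegree * x ^ (d - p.natDegree) := by
      rw [← pow_add]; congr 1; omega
    rw [this]; ring


section maps
variable {d : ℕ} {F₀ F₁ : MvPolynomial (Fin 2) ℂ}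

lemma Fmap_smul (h₀ : F₀.IsHomogeneous d) (h₁ : F₁.IsHomogeneous d) (c : ℂ) (Z : ℂ × ℂ) :
    Fmap F₀ F₁ (c • Z) = c ^ d • Fmap F₀ F₁ Z := by
  simp [Fmap, ev_smul h₀, ev_smul h₁]

lemma iter_smul (h₀ : F₀.IsHomogeneous d) (h₁ : F₁.IsHomogeneous d) (c : ℂ) (Z : ℂ × ℂ) (k : ℕ) :
    (Fmap F₀ F₁)^[k] (c • Z) = c ^ (d ^ k) • (Fmap F₀ F₁)^[k] Z := by
  induction k with
  | zero => simp
  | succ k ih =>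
    rw [Function.iterate_succ_apply', ih, Fmap_smul h₀ h₁, Function.iterate_succ_apply',
      ← pow_mul, pow_succ]

lemma Fmap_ne (hcz : ∀ Z : ℂ × ℂ, ev F₀ Z = 0 → ev F₁ Z = 0 → Z = 0) (Z : ℂ × ℂ) (hZ : Z ≠ 0) :
    Fmap F₀ F₁ Z ≠ 0 := by
  intro h
  exact hZ (hcz Z (congrArg Prod.fst h) (congrArg Prod.snd h))

lemma iter_ne (hcz : ∀ Z : ℂ × ℂ, ev F₀ Z = 0 → ev F₁ Z = 0 → Z = 0) (k : ℕ) (Z : ℂ × ℂ)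
    (hZ : Z ≠ 0) : (Fmap F₀ F₁)^[k] Z ≠ 0 := by
  induction k with
  | zero => simpa
  | succ k ih => rw [Function.iterate_succ_apply']; exact Fmap_ne hcz _ ih

lemma enorm2_smul (c : ℂ) (Z : ℂ × ℂ) : enorm2 (c • Z) = ‖c‖ * enorm2 Z := by
  simp only [enorm2, Prod.smul_fst, Prod.smul_snd, smul_eq_mul, norm_mul]
  rw [show (‖c‖ * ‖Z.1‖) ^ 2 + (‖c‖ * ‖Z.2‖) ^ 2 = ‖c‖ ^ 2 * (‖Z.1‖ ^ 2 + ‖Z.2‖ ^ 2) by ring,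
    Real.sqrt_mul (sq_nonneg _), Real.sqrt_sq (norm_nonneg _)]

lemma enorm2_ne (Z : ℂ × ℂ) (hZ : Z ≠ 0) : enorm2 Z ≠ 0 := by
  intro h
  have h2 : ‖Z.1‖ ^ 2 + ‖Z.2‖ ^ 2 = 0 := (Real.sqrt_eq_zero (by positivity)).1 h
  apply hZ
  have a := sq_nonneg ‖Z.1‖
  have b := sq_nonneg ‖Z.2‖
  have a' : ‖Z.1‖ ^ 2 = 0 := by linarith
  have b' : ‖Z.2‖ ^ 2 = 0 := by linarith
  exact Prod.ext (by simpa using a') (by simpa using b')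

lemma G_smul (hd : 2 ≤ d) (h₀ : F₀.IsHomogeneous d) (h₁ : F₁.IsHomogeneous d)
    (hcz : ∀ Z : ℂ × ℂ, ev F₀ Z = 0 → ev F₁ Z = 0 → Z = 0)
    {G : ℂ × ℂ → ℝ}
    (hG : ∀ Z : ℂ × ℂ, Z ≠ 0 → Tendsto
      (fun k : ℕ => Real.log (enorm2 ((Fmap F₀ F₁)^[k] Z)) / (d : ℝ) ^ k)
      atTop (nhds (G Z))) (c : ℂ) (Z : ℂ × ℂ) (hc : c ≠ 0) (hZ : Z ≠ 0) :
    G (c • Z) = Real.log ‖c‖ + G Z := by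
  refine tendsto_nhds_unique (hG _ (smul_ne_zero hc hZ)) ?_
  refine ((hG Z hZ).const_add (Real.log ‖c‖)).congr fun k => ?_
  rw [iter_smul h₀ h₁, enorm2_smul, Real.log_mul (by simpa using fun h => absurd h hc)
    (enorm2_ne _ (iter_ne hcz k Z hZ)), norm_pow, Real.log_pow]
  have : (d : ℝ) ^ k ≠ 0 := by positivity
  push_cast
  field_simp

lemma G_map (hd : 2 ≤ d)
    (hcz : ∀ Z : ℂ × ℂ, ev F₀ Z = 0 → ev F₁ Z = 0 → Z = 0)
    {G : ℂ × ℂ → ℝ}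
    (hG : ∀ Z : ℂ × ℂ, Z ≠ 0 → Tendsto
      (fun k : ℕ => Real.log (enorm2 ((Fmap F₀ F₁)^[k] Z)) / (d : ℝ) ^ k)
      atTop (nhds (G Z))) (Z : ℂ × ℂ) (hZ : Z ≠ 0) :
    G (Fmap F₀ F₁ Z) = d * G Z := by
  refine tendsto_nhds_unique (hG _ (Fmap_ne hcz Z hZ)) ?_
  refine (((tendsto_add_atTop_iff_nat 1).2 (hG Z hZ)).const_mul (d : ℝ)).congr fun k => ?_
  have : (d : ℝ) ≠ 0 := by positivity
  rw [Function.iterate_succ_apply]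
  field_simp
  ring

lemma G_iter (hd : 2 ≤ d)
    (hcz : ∀ Z : ℂ × ℂ, ev F₀ Z = 0 → ev F₁ Z = 0 → Z = 0)
    {G : ℂ × ℂ → ℝ}
    (hG : ∀ Z : ℂ × ℂ, Z ≠ 0 → Tendsto
      (fun k : ℕ => Real.log (enorm2 ((Fmap F₀ F₁)^[k] Z)) / (d : ℝ) ^ k)
      atTop (nhds (G Z))) (m : ℕ) (Z : ℂ × ℂ) (hZ : Z ≠ 0) :
    G ((Fmap F₀ F₁)^[m] Z) = ((d ^ m : ℕ) : ℝ) * G Z := by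
  induction m with
  | zero => simp
  | succ m ih =>
    rw [Function.iterate_succ_apply', G_map hd hcz hG _ (iter_ne hcz m Z hZ), ih]
    push_cast; ring

lemma exists_fac (hd : 2 ≤ d) (h₀ : F₀.IsHomogeneous d) (h₁ : F₁.IsHomogeneous d)
    (hcz : ∀ Z : ℂ × ℂ, ev F₀ Z = 0 → ev F₁ Z = 0 → Z = 0)
    {A : Fin d → ℂ × ℂ} (hA : ∀ i, A i ≠ 0)
    (hfac : ∀ Z : ℂ × ℂ, ev F₀ Z = ∏ i, wedge Z (A i)) (W : ℂ × ℂ) (hW : W ≠ 0)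
    (hW1 : W.1 ≠ 0) :
    ∃ (ι : Type) (_ : Fintype ι) (B : ι → ℂ × ℂ),
      Fintype.card ι = d ∧ IsFac (Fmap F₀ F₁) W B := by
  have hev : ∀ Z, ev (C W.2 * F₀ - C W.1 * F₁) Z = wedge (Fmap F₀ F₁ Z) W := by
    intro Z; simp [ev, wedge, Fmap]; ring
  have hhom : (C W.2 * F₀ - C W.1 * F₁).IsHomogeneous d := by
    apply IsHomogeneous.sub
    · simpa using (isHomogeneous_C (Fin 2) W.2).mul h₀
    · simpa using (isHomogeneous_C (Fin 2) W.1).mul h₁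
  obtain ⟨ι, i1, B, hc, hB, hf⟩ := factor (by omega) hhom (by
    let i : Fin d := ⟨0, by omega⟩
    refine ⟨A i, ?_⟩
    have h0 : ev F₀ (A i) = 0 := by
      rw [hfac]; exact Finset.prod_eq_zero (Finset.mem_univ i) (wedge_self _)
    rw [hev]
    simp only [wedge, Fmap, h0, zero_mul, zero_sub, neg_ne_zero]
    exact mul_ne_zero (fun h => hA i (hcz _ h0 h)) hW1)
  exact ⟨ι, i1, B, hc, hB, fun Z => by rw [← hev, hf]⟩

lemma base (hd : 2 ≤ d) (h₀ : F₀.IsHomogeneous d) (h₁ : F₁.IsHomogeneous d)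
    (hcz : ∀ Z : ℂ × ℂ, ev F₀ Z = 0 → ev F₁ Z = 0 → Z = 0)
    {G : ℂ × ℂ → ℝ}
    (hG : ∀ Z : ℂ × ℂ, Z ≠ 0 → Tendsto
      (fun k : ℕ => Real.log (enorm2 ((Fmap F₀ F₁)^[k] Z)) / (d : ℝ) ^ k)
      atTop (nhds (G Z)))
    {A : Fin d → ℂ × ℂ} (hA : ∀ i, A i ≠ 0)
    (hfac : ∀ Z : ℂ × ℂ, ev F₀ Z = ∏ i, wedge Z (A i))
    (hres : ∏ i, ‖ev F₁ (A i)‖ = 1) (W : ℂ × ℂ) (hW : W ≠ 0) :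
    ∃ (ι : Type) (_ : Fintype ι) (B : ι → ℂ × ℂ),
      Fintype.card ι = d ∧ IsFac (Fmap F₀ F₁) W B ∧ ∑ i, G (B i) = G W := by
  have hGs := G_smul hd h₀ h₁ hcz hG
  have hGF := G_map hd hcz hG
  have hE : ((0, 1) : ℂ × ℂ) ≠ 0 := by simp
  have hfE : IsFac (Fmap F₀ F₁) (0, 1) A := ⟨hA, fun Z => by rw [← hfac]; simp [wedge, Fmap]⟩
  have hA0 : ∀ i, ev F₀ (A i) = 0 := fun i => by
    rw [hfac]; exact Finset.prod_eq_zero (Finset.mem_univ i) (wedge_self _)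
  have hsE : ∑ i, G (A i) = G (0, 1) := by
    have := sumlog hGs hGF hE hA (by simp) (c := fun i => ev F₁ (A i))
      (fun i h => hA i (hcz _ (hA0 i) h)) (fun i => by simp [Fmap, hA0 i])
    rw [hres, Real.log_one] at this
    have hd' : (d : ℝ) ≠ 0 := by positivity
    have : (∑ i, G (A i)) - G (0, 1) = 0 := by simpa [hd'] using this.symm
    linarith
  by_cases hW1 : W.1 = 0
  · have hW2 : W.2 ≠ 0 := fun h => hW (Prod.ext hW1 h)
    have hα : ∃ α : ℂ, α ^ d = W.2 := IsAlgClosed.exists_pow_nat_eq _ (by omega)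
    obtain ⟨α, hα⟩ := hα
    have hα0 : α ≠ 0 := by
      rintro rfl
      rw [zero_pow (by omega)] at hα
      exact hW2 hα.symm
    have hWE : W = W.2 • ((0, 1) : ℂ × ℂ) := by ext <;> simp [hW1]
    refine ⟨Fin d, inferInstance, fun i => α • A i, by simp,
      ⟨fun i => smul_ne_zero hα0 (hA i), fun Z => ?_⟩, ?_⟩
    · simp_rw [wedge_smul_right]
      rw [Finset.prod_mul_distrib, ← hfE.2]
      conv_lhs => rw [hWE, wedge_smul_right]
      simp [hα]
    · simp_rw [hGs α _ hα0 (hA _)]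
      rw [Finset.sum_add_distrib, hsE]
      conv_rhs => rw [hWE, hGs _ _ hW2 hE, ← hα, norm_pow, Real.log_pow]
      simp
  · obtain ⟨ι, i1, B, hc, hB⟩ := exists_fac hd h₀ h₁ hcz hA hfac W hW hW1
    refine ⟨ι, i1, B, hc, hB, ?_⟩
    exact transfer (by omega) hGs hGF (Fmap_ne hcz) hE hW (by simp) hc hfE hB
      (by simpa [wedge] using hW1) hsE

lemma iter_fac {Φ : ℂ × ℂ → ℂ × ℂ} {G : ℂ × ℂ → ℝ}
    (hb : ∀ W : ℂ × ℂ, W ≠ 0 → ∃ (ι : Type) (_ : Fintype ι) (B : ι → ℂ × ℂ),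
      Fintype.card ι = d ∧ IsFac Φ W B ∧ ∑ i, G (B i) = G W) (m : ℕ) :
    ∀ W : ℂ × ℂ, W ≠ 0 → ∃ (ι : Type) (_ : Fintype ι) (B : ι → ℂ × ℂ),
      Fintype.card ι = d ^ m ∧ IsFac (Φ^[m]) W B ∧ ∑ i, G (B i) = G W := by
  induction m with
  | zero =>
    intro W hW
    exact ⟨Unit, inferInstance, fun _ => W, by simp, ⟨fun _ => hW, fun Z => by simp⟩, by simp⟩
  | succ m ih =>
    intro W hW
    obtain ⟨ι, _, B, hc, hB, hs⟩ := hb W hW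
    choose κ hκ B' hc' hB' hs' using fun i => ih (B i) (hB.1 i)
    refine ⟨Σ i, κ i, inferInstance, fun x => B' x.1 x.2, ?_, ⟨fun x => (hB' x.1).1 x.2, ?_⟩, ?_⟩
    · rw [Fintype.card_sigma]
      simp [hc', hc, pow_succ, mul_comm]
    · intro Z
      rw [Function.iterate_succ_apply', hB.2, Fintype.prod_sigma]
      exact Finset.prod_congr rfl fun i _ => (hB' i).2 Z
    · rw [Fintype.sum_sigma, ← hs]
      exact Finset.sum_congr rfl fun i _ => hs' i

end maps

end Dyn10


/-- Assume `|Res F| = 1`.  Fix `n ≥ 1` and dynatomic data: for every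
divisor `m` of `n`, points `Z^{(m)}_j ∈ ℂ² ∖ {0}` (`1 ≤ j ≤ d_m`) such that for all
divisors `m` of `n` and all `Z`, `F^m(Z) ∧ Z = ∏_{k ∣ m} ∏_j (Z ∧ Z^{(k)}_j)`.
Then `∑_{j=1}^{d_n} G^F(Z^{(n)}_j) = 0`. -/
theorem stmt10 (d : ℕ) (hd : 2 ≤ d) (F₀ F₁ : MvPolynomial (Fin 2) ℂ)
    (h₀ : F₀.IsHomogeneous d) (h₁ : F₁.IsHomogeneous d)
    (hcz : ∀ Z : ℂ × ℂ, ev F₀ Z = 0 → ev F₁ Z = 0 → Z = 0)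
    (G : ℂ × ℂ → ℝ)
    (hG : ∀ Z : ℂ × ℂ, Z ≠ 0 → Tendsto
      (fun k : ℕ => Real.log (enorm2 ((Fmap F₀ F₁)^[k] Z)) / (d : ℝ) ^ k)
      atTop (nhds (G Z)))
    (A : Fin d → ℂ × ℂ) (hA : ∀ i, A i ≠ 0)
    (hfac : ∀ Z : ℂ × ℂ, ev F₀ Z = ∏ i, wedge Z (A i))
    (hres : ∏ i, ‖ev F₁ (A i)‖ = 1)
    (n : ℕ) (hn : 1 ≤ n)
    (Zp : ℕ → ℕ → ℂ × ℂ)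
    (hZp : ∀ m ∈ n.divisors, ∀ j ∈ Finset.range (dyndeg d m).toNat, Zp m j ≠ 0)
    (hdyn : ∀ m ∈ n.divisors, ∀ Z : ℂ × ℂ,
      wedge ((Fmap F₀ F₁)^[m] Z) Z =
        ∏ k ∈ m.divisors, ∏ j ∈ Finset.range (dyndeg d k).toNat, wedge Z (Zp k j)) :
    ∑ j ∈ Finset.range (dyndeg d n).toNat, G (Zp n j) = 0 := by
  have hb := Dyn10.base hd h₀ h₁ hcz hG hA hfac hres
  have hGs := Dyn10.G_smul hd h₀ h₁ hcz hG
  have htot : ∀ m ∈ n.divisors,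
      ∑ k ∈ m.divisors, ∑ j ∈ Finset.range (dyndeg d k).toNat, G (Zp k j) = 0 := by
    intro m hm
    have hm0 : m ≠ 0 := (Nat.pos_of_mem_divisors hm).ne'
    have hmn := Nat.dvd_of_mem_divisors hm
    let T : Finset (Σ _ : ℕ, ℕ) := m.divisors.sigma fun k => Finset.range (dyndeg d k).toNat
    have := Dyn10.final (Φ := (Fmap F₀ F₁)^[m]) (D := d ^ m)
      (hd.trans (Nat.le_self_pow hm0 d)) hGs (Dyn10.G_iter hd hcz hG m) (Dyn10.iter_ne hcz m)
      (Dyn10.iter_fac hb m) (τ := T) (fun x => Zp x.1.1 x.1.2)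
      (fun x => by
        obtain ⟨h1, h2⟩ := Finset.mem_sigma.1 x.2
        exact hZp _ (Nat.mem_divisors.2 ⟨(Nat.dvd_of_mem_divisors h1).trans hmn, by omega⟩) _ h2)
      (fun Z => by
        rw [hdyn m hm Z, Finset.prod_sigma']
        exact (Finset.prod_coe_sort T (fun x => wedge Z (Zp x.1 x.2))).symm)
    rw [Finset.sum_sigma', ← this]
    exact (Finset.sum_coe_sort T (fun x => G (Zp x.1 x.2))).symm
  have hall : ∀ m, m ∈ n.divisors → ∑ j ∈ Finset.range (dyndeg d m).toNat, G (Zp m j) = 0 := by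
    intro m
    induction m using Nat.strong_induction_on with
    | _ m ih =>
      intro hm
      have hm0 : m ≠ 0 := (Nat.pos_of_mem_divisors hm).ne'
      have h := htot m hm
      rw [← Nat.insert_self_properDivisors hm0,
        Finset.sum_insert Nat.self_notMem_properDivisors] at h
      rw [Finset.sum_eq_zero (s := m.properDivisors), add_zero] at h
      · exact h
      · intro k hk
        obtain ⟨h1, h2⟩ := Nat.mem_properDivisors.1 hk
        exact ih k h2 (Nat.mem_divisors.2 ⟨h1.trans (Nat.dvd_of_mem_divisors hm), by omega⟩)
  exact hall n (Nat.mem_divisors_self n (by omega))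
end

section
/- Assume |Res F| = 1, i.e. there exist A₁,…,A_d ∈ ℂ² ∖ {(0,0)} with F₀(Z) = ∏_{i=1}^d (Z ∧ A_i) for all Z ∈ ℂ² and ∏_{i=1}^d |F₁(A_i)| = 1. Suppose q₁,…,q_{d+1} ∈ ℂ² ∖ {(0,0)} satisfy F(Z) ∧ Z = ∏_{j=1}^{d+1} (Z ∧ q_j) for all Z ∈ ℂ². Suppose moreover that for some index k we have q_k = (1, z) with z ∈ ℂ, that F₀(1,z) ≠ 0, and that q_k ∧ q_j ≠ 0 for every j ≠ k (so z is a simple fixed point of the rational map f : w ↦ F₁(1,w)/F₀(1,w)). Then log |f′(z) − 1| = ∑_{j ≠ k} log |q_k ∧ q_j| − (d−1)·G^F(q_k), where f′(z) denotes the derivative of f at z. -/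
open Filter Finset MvPolynomial

lemma ev_smul {P : MvPolynomial (Fin 2) ℂ} {d : ℕ} (h : P.IsHomogeneous d) (c : ℂ) (Z : ℂ × ℂ) :
    ev P (c • Z) = c ^ d * ev P Z := by
  unfold ev
  have h2 : (![(c • Z).1, (c • Z).2] : Fin 2 → ℂ) = c • ![Z.1, Z.2] := by
    ext i; fin_cases i <;> simp
  rw [h2, MvPolynomial.eval_eq', MvPolynomial.eval_eq', Finset.mul_sum]
  refine Finset.sum_congr rfl fun m hm => ?_
  have hdeg := h (MvPolynomial.mem_support_iff.mp hm)
  have hdeg' : m 0 + m 1 = d := by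
    rw [← hdeg, Finsupp.weight_apply, Finsupp.sum_fintype _ _ (by simp)]
    simp [Fin.sum_univ_two]
  rw [← hdeg']
  simp [Fin.prod_univ_two]
  ring

lemma enorm2_smul (c : ℂ) (Z : ℂ × ℂ) : enorm2 (c • Z) = ‖c‖ * enorm2 Z := by
  unfold enorm2
  have : ‖(c • Z).1‖ ^ 2 + ‖(c • Z).2‖ ^ 2 = ‖c‖ ^ 2 * (‖Z.1‖ ^ 2 + ‖Z.2‖ ^ 2) := by
    simp
    ring
  rw [this, Real.sqrt_mul (by positivity), Real.sqrt_sq (norm_nonneg c)]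

lemma ev_differentiable (P : MvPolynomial (Fin 2) ℂ) : Differentiable ℂ (fun w : ℂ => ev P (1, w)) := by
  have : (fun w : ℂ => ev P (1, w)) =
      fun w => ∑ m ∈ P.support, P.coeff m * ((1 : ℂ) ^ (m 0) * w ^ (m 1)) := by
    ext w
    simp [ev, MvPolynomial.eval_eq', Fin.prod_univ_two]
  rw [this]
  fun_prop

/-- Assume `|Res F| = 1`.  Let `q₁, …, q_{d+1}` factor the fixed point
divisor: `F(Z) ∧ Z = ∏ⱼ (Z ∧ qⱼ)`.  If `q_k = (1, z)` with `F₀(1,z) ≠ 0` and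
`q_k ∧ q_j ≠ 0` for `j ≠ k` (so `z` is a simple fixed point of
`f : w ↦ F₁(1,w)/F₀(1,w)`), then
`log |f′(z) − 1| = ∑_{j ≠ k} log |q_k ∧ q_j| − (d−1) G^F(q_k)`. -/
theorem stmt11 (d : ℕ) (hd : 2 ≤ d) (F₀ F₁ : MvPolynomial (Fin 2) ℂ)
    (h₀ : F₀.IsHomogeneous d) (h₁ : F₁.IsHomogeneous d)
    (hcz : ∀ Z : ℂ × ℂ, ev F₀ Z = 0 → ev F₁ Z = 0 → Z = 0)
    (G : ℂ × ℂ → ℝ)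
    (hG : ∀ Z : ℂ × ℂ, Z ≠ 0 → Tendsto
      (fun n : ℕ => Real.log (enorm2 ((Fmap F₀ F₁)^[n] Z)) / (d : ℝ) ^ n)
      atTop (nhds (G Z)))
    (A : Fin d → ℂ × ℂ) (hA : ∀ i, A i ≠ 0)
    (hfac : ∀ Z : ℂ × ℂ, ev F₀ Z = ∏ i, wedge Z (A i))
    (hres : ∏ i, ‖ev F₁ (A i)‖ = 1)
    (q : Fin (d + 1) → ℂ × ℂ) (hq : ∀ j, q j ≠ 0)
    (hfix : ∀ Z : ℂ × ℂ, wedge (Fmap F₀ F₁ Z) Z = ∏ j, wedge Z (q j))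
    (k : Fin (d + 1)) (z : ℂ) (hqk : q k = (1, z)) (hF₀z : ev F₀ (1, z) ≠ 0)
    (hsimple : ∀ j, j ≠ k → wedge (q k) (q j) ≠ 0) :
    Real.log ‖deriv (fun w : ℂ => ev F₁ (1, w) / ev F₀ (1, w)) z - 1‖ =
      (∑ j ∈ Finset.univ.erase k, Real.log ‖wedge (q k) (q j)‖) -
        ((d : ℝ) - 1) * G (q k) := by
  set l := ev F₀ (1, z) with hl
  have hFq : Fmap F₀ F₁ (q k) = l • q k := by
    have h := hfix (q k)
    rw [Finset.prod_eq_zero (Finset.mem_univ k) (by simp [wedge]; ring)] at h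
    rw [hqk] at h ⊢
    simp only [wedge, Fmap] at h
    ext
    · simp [Fmap, hl]
    · simp only [Fmap, Prod.smul_mk, smul_eq_mul]
      linear_combination -h
  have hd1 : (0 : ℝ) < d - 1 := by
    have : (2 : ℝ) ≤ d := by exact_mod_cast hd
    linarith
  have hiter : ∀ n : ℕ, ∃ c : ℂ, c ≠ 0 ∧ (Fmap F₀ F₁)^[n] (q k) = c • q k ∧
      ((d : ℝ) - 1) * Real.log ‖c‖ = ((d : ℝ) ^ n - 1) * Real.log ‖l‖ := by
    intro n
    induction n with
    | zero => exact ⟨1, one_ne_zero, by simp, by simp⟩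
    | succ n ih =>
      obtain ⟨c, hc, h1, h2⟩ := ih
      refine ⟨c ^ d * l, mul_ne_zero (pow_ne_zero _ hc) hF₀z, ?_, ?_⟩
      · rw [Function.iterate_succ_apply', h1, mul_smul, ← hFq]
        simp [Fmap, ev_smul h₀, ev_smul h₁]
      · rw [norm_mul, norm_pow, Real.log_mul (pow_ne_zero _ (norm_ne_zero_iff.mpr hc))
          (norm_ne_zero_iff.mpr hF₀z), Real.log_pow]
        rw [pow_succ]
        linear_combination (d : ℝ) * h2
  have hen : enorm2 (q k) ≠ 0 := by
    rw [hqk]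
    unfold enorm2
    simp only [norm_one]
    positivity
  have hGq : ((d : ℝ) - 1) * G (q k) = Real.log ‖l‖ := by
    have t1 := (hG (q k) (hq k)).const_mul ((d : ℝ) - 1)
    have t3 : Tendsto (fun n : ℕ => ((d : ℝ) ^ n)⁻¹) atTop (nhds 0) :=
      tendsto_inv_atTop_zero.comp (tendsto_pow_atTop_atTop_of_one_lt (by linarith))
    have t2 : Tendsto (fun n : ℕ => Real.log ‖l‖ +
        (((d : ℝ) - 1) * Real.log (enorm2 (q k)) - Real.log ‖l‖) * ((d : ℝ) ^ n)⁻¹) atTop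
        (nhds (Real.log ‖l‖)) := by
      simpa using (t3.const_mul
        (((d : ℝ) - 1) * Real.log (enorm2 (q k)) - Real.log ‖l‖)).const_add (Real.log ‖l‖)
    refine tendsto_nhds_unique t1 (t2.congr fun n => ?_)
    obtain ⟨c, hc, e1, e2⟩ := hiter n
    rw [e1, enorm2_smul, Real.log_mul (norm_ne_zero_iff.mpr hc) hen]
    have : (d : ℝ) ^ n ≠ 0 := pow_ne_zero _ (by linarith)
    field_simp
    linear_combination -e2
  rw [hGq]
  have hder : HasDerivAt (fun w : ℂ => ev F₁ (1, w) / ev F₀ (1, w))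
      (1 + (∏ j ∈ Finset.univ.erase k, wedge (q k) (q j)) / l) z := by
    have dH : DifferentiableAt ℂ (fun w : ℂ =>
        (∏ j ∈ Finset.univ.erase k, wedge (1, w) (q j)) / ev F₀ (1, w)) z := by
      refine DifferentiableAt.div ?_ (ev_differentiable F₀ z) hF₀z
      unfold wedge
      fun_prop
    have key := (hasDerivAt_id z).add (((hasDerivAt_id z).sub_const z).mul dH.hasDerivAt)
    have key2 := key.congr_deriv
      (g' := 1 + (∏ j ∈ Finset.univ.erase k, wedge (q k) (q j)) / l) (by simp [hqk, hl])
    refine key2.congr_of_eventuallyEq ?_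
    filter_upwards [(ev_differentiable F₀ z).continuousAt.eventually_ne hF₀z] with w hw
    have h := hfix (1, w)
    rw [← Finset.mul_prod_erase _ _ (Finset.mem_univ k)] at h
    have hk : wedge (1, w) (q k) = z - w := by simp [wedge, hqk]
    rw [hk] at h
    simp only [Pi.add_apply, Pi.mul_apply, id]
    rw [div_eq_iff hw, add_mul, mul_assoc, div_mul_cancel₀ _ hw]
    have h' : wedge (Fmap F₀ F₁ (1, w)) (1, w) = ev F₀ (1, w) * w - ev F₁ (1, w) := by
      simp [wedge, Fmap]
    rw [h'] at h
    linear_combination -h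
  rw [hder.deriv, add_sub_cancel_left, norm_div, Real.log_div, norm_prod, Real.log_prod]
  · intro j hj
    exact norm_ne_zero_iff.mpr (hsimple j (Finset.ne_of_mem_erase hj))
  · exact norm_ne_zero_iff.mpr (Finset.prod_ne_zero_iff.mpr
      fun j hj => hsimple j (Finset.ne_of_mem_erase hj))
  · exact norm_ne_zero_iff.mpr hF₀z
end

section
/- Assume |Res F| = 1, i.e. there exist A₁,…,A_d ∈ ℂ² ∖ {(0,0)} with F₀(Z) = ∏_{i=1}^d (Z ∧ A_i) for all Z ∈ ℂ² and ∏_{i=1}^d |F₁(A_i)| = 1. Then, in the setting of the dynatomic data below, for every divisor ℓ of n with ℓ < n: ∏_{i=1}^{d_n} ∏_{j=1}^{d_ℓ} |Z^{(n)}_i ∧ Z^{(ℓ)}_j| = ∏_{j=1}^{d_ℓ} |C_{n/ℓ}(λ^{(ℓ)}_j)|. (The left-hand side is the absolute value of the homogeneous resultant Res(Φ^{**}_{F,n}, Φ^{**}_{F,ℓ}) of the n-th and ℓ-th dynatomic polynomials; this is the second displayed equality of the paper's main Theorem, |R^{**}_{n,ℓ}| = |Δ_{n,ℓ}|^ℓ,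 in the normalization |Res F| = 1.) -/
open Filter Finset MvPolynomial

/-- The affine coordinate `z^{(m)}_j` of the point `Z^{(m)}_j = u·(1, z^{(m)}_j)`. -/
noncomputable def zc (Zp : ℕ → ℕ → ℂ × ℂ) (m j : ℕ) : ℂ := (Zp m j).2 / (Zp m j).1

/-- The multiplier `λ^{(m)}_j`: the derivative at `z^{(m)}_j` of the map
`w ↦ F₁^{(m)}(1,w) / F₀^{(m)}(1,w)` induced by the `m`-th iterate of `F`. -/
noncomputable def lam (F₀ F₁ : MvPolynomial (Fin 2) ℂ) (Zp : ℕ → ℕ → ℂ × ℂ) (m j : ℕ) : ℂ :=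
  deriv (fun w : ℂ => ((Fmap F₀ F₁)^[m] (1, w)).2 / ((Fmap F₀ F₁)^[m] (1, w)).1) (zc Zp m j)


section Basics

theorem wedge_smul_left (t : ℂ) (Z W : ℂ × ℂ) : wedge (t • Z) W = t * wedge Z W := by
  simp [wedge]; ring

theorem wedge_smul_right (t : ℂ) (Z W : ℂ × ℂ) : wedge Z (t • W) = t * wedge Z W := by
  simp [wedge]; ring

theorem wedge_self (Z : ℂ × ℂ) : wedge Z Z = 0 := by simp [wedge]; ring

theorem wedge_zero_left (Z : ℂ × ℂ) : wedge 0 Z = 0 := by simp [wedge]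

theorem norm_wedge_comm (Z W : ℂ × ℂ) : ‖wedge Z W‖ = ‖wedge W Z‖ := by
  rw [← norm_neg]; congr 1; simp [wedge]; ring

theorem exists_smul_of_wedge {Z u : ℂ × ℂ} (hu : u ≠ 0) (h : wedge Z u = 0) :
    ∃ k : ℂ, Z = k • u := by
  obtain ⟨a, b⟩ := u
  obtain ⟨x, y⟩ := Z
  simp only [wedge] at h
  by_cases ha : a = 0
  · have hb : b ≠ 0 := by
      intro hb; exact hu (by simp [ha, hb])
    refine ⟨y / b, ?_⟩
    subst ha
    have : x = 0 := by
      have : x * b = 0 := by linear_combination h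
      exact (mul_eq_zero.mp this).resolve_right hb
    ext
    · simp [this]
    · simp; field_simp
  · refine ⟨x / a, ?_⟩
    ext
    · simp; field_simp
    · simp; field_simp; linear_combination -h

/-- splitting of a dehomogenised binary form -/
theorem homogenize_split (D : ℕ) : ∀ p : Polynomial ℂ, p.natDegree ≤ D →
    ∃ (c : ℂ) (A : Fin D → ℂ × ℂ), ∀ Z : ℂ × ℂ, ev (p.homogenize D) Z = c * ∏ i, wedge Z (A i) := by
  induction D with
  | zero =>
    intro p hp
    rw [Polynomial.eq_C_of_natDegree_le_zero hp]
    refine ⟨p.coeff 0, fun _ => 0, fun Z => ?_⟩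
    simp [ev]
  | succ D ih =>
    intro p hp
    by_cases hpD : p.natDegree ≤ D
    · obtain ⟨c, A, h⟩ := ih p hpD
      refine ⟨c, Fin.cons (-1, 0) A, fun Z => ?_⟩
      have := Polynomial.homogenize_mul p 1 hpD (n := 1) (by simp)
      rw [mul_one] at this
      have h' := h Z
      simp only [ev] at h'
      rw [Fin.prod_univ_succ]
      simp only [ev, this, map_mul, h', Fin.cons_zero, Fin.cons_succ]
      simp [wedge]; ring
    · have hd : p.degree ≠ 0 := by
        intro h
        have := Polynomial.natDegree_eq_zero_iff_degree_le_zero.mpr h.le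
        omega
      obtain ⟨r, hr⟩ := IsAlgClosed.exists_root p hd
      obtain ⟨q, hq⟩ := Polynomial.dvd_iff_isRoot.mpr hr
      have hq0 : q ≠ 0 := by
        rintro rfl
        apply hpD
        simp [hq]
      have hqD : q.natDegree ≤ D := by
        have := congrArg Polynomial.natDegree hq
        rw [Polynomial.natDegree_mul (Polynomial.X_sub_C_ne_zero r) hq0,
          Polynomial.natDegree_X_sub_C] at this
        omega
      obtain ⟨c, A, h⟩ := ih q hqD
      refine ⟨c, Fin.cons (r, 1) A, fun Z => ?_⟩
      have := Polynomial.homogenize_mul q (Polynomial.X - Polynomial.C r) hqD (n := 1) (by simp)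
      rw [mul_comm, ← hq] at this
      have h' := h Z
      simp only [ev] at h'
      rw [Fin.prod_univ_succ]
      simp only [ev, this, map_mul, h', Fin.cons_zero, Fin.cons_succ]
      have h2 : (Polynomial.X - Polynomial.C r).homogenize 1
          = MvPolynomial.X 0 - MvPolynomial.C r * MvPolynomial.X 1 := by
        rw [sub_eq_add_neg, Polynomial.homogenize_add, ← Polynomial.C_neg]
        rw [Polynomial.homogenize_X one_ne_zero, Polynomial.homogenize_C]
        simp; ring
      rw [h2]
      simp [wedge]; ring

theorem form_split {D : ℕ} (hD : 1 ≤ D) (P : MvPolynomial (Fin 2) ℂ) (hP : P.IsHomogeneous D) :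
    ∃ A : Fin D → ℂ × ℂ, ∀ Z : ℂ × ℂ, ev P Z = ∏ i, wedge Z (A i) := by
  have hdeg : (MvPolynomial.aeval ![Polynomial.X, 1] P : Polynomial ℂ).natDegree ≤ D := by
    rw [MvPolynomial.aeval_def, MvPolynomial.eval₂_eq']
    apply Polynomial.natDegree_sum_le_of_forall_le
    intro e he
    have h1 := hP (MvPolynomial.mem_support_iff.mp he)
    rw [Finsupp.weight_apply, Finsupp.sum_fintype _ _ (by simp)] at h1
    simp at h1
    simp only [Fin.prod_univ_two, Matrix.cons_val_zero, Matrix.cons_val_one, one_pow, mul_one]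
    refine (Polynomial.natDegree_C_mul_X_pow_le _ _).trans (by omega)
  have h1 := Polynomial.homogenize_eq_of_isHomogeneous hP rfl
  obtain ⟨c, A, h⟩ := homogenize_split D _ hdeg
  rw [h1] at h
  obtain ⟨E, rfl⟩ : ∃ E, D = E + 1 := ⟨D - 1, by omega⟩
  refine ⟨Fin.cons (c • A 0) (Fin.tail A), fun Z => ?_⟩
  rw [h, Fin.prod_univ_succ, Fin.prod_univ_succ, Fin.cons_zero, wedge_smul_right]
  simp [Fin.tail]; ring

/-- the pair as a self-map of `S²` for any `ℂ`-algebra `S` -/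
noncomputable def FS {S : Type} [CommRing S] [Algebra ℂ S] (F₀ F₁ : MvPolynomial (Fin 2) ℂ)
    (x : S × S) : S × S :=
  (MvPolynomial.aeval ![x.1, x.2] F₀, MvPolynomial.aeval ![x.1, x.2] F₁)

/-- the wedge over a ring -/
def wS {S : Type} [CommRing S] (Z W : S × S) : S := Z.1 * W.2 - Z.2 * W.1

theorem FS_eq_Fmap (F₀ F₁ : MvPolynomial (Fin 2) ℂ) :
    (FS F₀ F₁ : ℂ × ℂ → ℂ × ℂ) = Fmap F₀ F₁ := by
  funext x
  simp [FS, Fmap, ev, MvPolynomial.aeval_eq_eval]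

theorem FS_iter_map {S T : Type} [CommRing S] [Algebra ℂ S] [CommRing T] [Algebra ℂ T]
    (F₀ F₁ : MvPolynomial (Fin 2) ℂ) (φ : S →ₐ[ℂ] T) (m : ℕ) (x : S × S) :
    (FS F₀ F₁)^[m] (φ x.1, φ x.2) =
      (φ ((FS F₀ F₁)^[m] x).1, φ ((FS F₀ F₁)^[m] x).2) := by
  have : Function.Semiconj (fun x : S × S => (φ x.1, φ x.2)) (FS F₀ F₁) (FS F₀ F₁) := by
    intro x
    have hx : ![φ x.1, φ x.2] = fun i => φ (![x.1, x.2] i) := by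
      funext i; fin_cases i <;> rfl
    have h (P : MvPolynomial (Fin 2) ℂ) : φ (MvPolynomial.aeval ![x.1, x.2] P)
        = MvPolynomial.aeval ![φ x.1, φ x.2] P := by
      rw [hx, ← MvPolynomial.comp_aeval_apply]
    simp only [FS, h]
  exact ((this.iterate_right m) x).symm

theorem aeval_hom {S : Type} [CommRing S] [Algebra ℂ S] {P : MvPolynomial (Fin 2) ℂ} {d : ℕ}
    (hP : P.IsHomogeneous d) (s : S) (x : S × S) :
    MvPolynomial.aeval ![s * x.1, s * x.2] P = s ^ d * MvPolynomial.aeval ![x.1, x.2] P := by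
  rw [MvPolynomial.aeval_def, MvPolynomial.eval₂_eq', MvPolynomial.aeval_def,
    MvPolynomial.eval₂_eq', Finset.mul_sum]
  refine Finset.sum_congr rfl fun e he => ?_
  have h1 := hP (MvPolynomial.mem_support_iff.mp he)
  rw [Finsupp.weight_apply, Finsupp.sum_fintype _ _ (by simp)] at h1
  simp at h1
  simp [← h1, mul_pow, pow_add]; ring

theorem FS_iter_smul {S : Type} [CommRing S] [Algebra ℂ S]
    {F₀ F₁ : MvPolynomial (Fin 2) ℂ} {d : ℕ} (h₀ : F₀.IsHomogeneous d) (h₁ : F₁.IsHomogeneous d)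
    (m : ℕ) (s : S) (x : S × S) :
    (FS F₀ F₁)^[m] (s • x) = s ^ (d ^ m) • (FS F₀ F₁)^[m] x := by
  induction m with
  | zero => simp
  | succ m ih =>
    rw [Function.iterate_succ_apply', ih, Function.iterate_succ_apply']
    ext
    · simp only [FS, Prod.smul_fst, Prod.smul_snd, smul_eq_mul]
      rw [aeval_hom h₀]; ring
    · simp only [FS, Prod.smul_fst, Prod.smul_snd, smul_eq_mul]
      rw [aeval_hom h₁]; ring

theorem Fmap_iter_smul {F₀ F₁ : MvPolynomial (Fin 2) ℂ} {d : ℕ} (h₀ : F₀.IsHomogeneous d)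
    (h₁ : F₁.IsHomogeneous d) (m : ℕ) (s : ℂ) (x : ℂ × ℂ) :
    (Fmap F₀ F₁)^[m] (s • x) = s ^ (d ^ m) • (Fmap F₀ F₁)^[m] x := by
  rw [← FS_eq_Fmap]; exact FS_iter_smul h₀ h₁ m s x

/-- the generic point -/
noncomputable def XX : MvPolynomial (Fin 2) ℂ × MvPolynomial (Fin 2) ℂ :=
  (MvPolynomial.X 0, MvPolynomial.X 1)

/-- the form `F^m(Z) ∧ Z` splits for every `m` -/
theorem Q_split {F₀ F₁ : MvPolynomial (Fin 2) ℂ} {d : ℕ} (h₀ : F₀.IsHomogeneous d)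
    (h₁ : F₁.IsHomogeneous d) (m : ℕ) :
    ∃ W : Fin (d ^ m + 1) → ℂ × ℂ, ∀ Z, wedge ((Fmap F₀ F₁)^[m] Z) Z = ∏ i, wedge Z (W i) := by
  have key : ∀ m, ((FS F₀ F₁)^[m] XX).1.IsHomogeneous (d ^ m) ∧
      ((FS F₀ F₁)^[m] XX).2.IsHomogeneous (d ^ m) := by
    intro m
    induction m with
    | zero => simp [XX, MvPolynomial.isHomogeneous_X]
    | succ m ih =>
      rw [Function.iterate_succ_apply']
      have hx : ∀ i, (![((FS F₀ F₁)^[m] XX).1, ((FS F₀ F₁)^[m] XX).2] i).IsHomogeneous (d ^ m) := by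
        intro i; fin_cases i
        · exact ih.1
        · exact ih.2
      rw [pow_succ]
      exact ⟨h₀.aeval _ hx, h₁.aeval _ hx⟩
  obtain ⟨k0, k1⟩ := key m
  obtain ⟨W, hW⟩ := form_split (D := d ^ m + 1) (by omega)
    (((FS F₀ F₁)^[m] XX).1 * MvPolynomial.X 1 -
      ((FS F₀ F₁)^[m] XX).2 * MvPolynomial.X 0)
    ((k0.mul (MvPolynomial.isHomogeneous_X _ _)).sub (k1.mul (MvPolynomial.isHomogeneous_X _ _)))
  refine ⟨W, fun Z => ?_⟩
  rw [← hW]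
  have := FS_iter_map F₀ F₁ (MvPolynomial.aeval ![Z.1, Z.2]) m
    XX
  simp [XX, FS_eq_Fmap, MvPolynomial.aeval_eq_eval] at this
  rw [this]
  simp [XX, ev, wedge]

end Basics

section Gamma

/-- normalised resultant condition, in coordinate free form -/
def Good (G : ℂ × ℂ → ℂ × ℂ) (D : ℕ) : Prop :=
  ∀ u : ℂ × ℂ, u ≠ 0 → ∃ (ι : Type) (_ : Fintype ι) (A : ι → ℂ × ℂ) (k : ι → ℂ),
    Fintype.card ι = D ∧ (∀ Z, wedge (G Z) u = ∏ i, wedge Z (A i)) ∧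
    (∀ i, G (A i) = k i • u) ∧ ∏ i, ‖k i‖ = 1

theorem good_switch {G : ℂ × ℂ → ℂ × ℂ} {ι κ : Type} [Fintype ι] [Fintype κ]
    {A : ι → ℂ × ℂ} {k : ι → ℂ} {B : κ → ℂ × ℂ} {l : κ → ℂ} {u v : ℂ × ℂ}
    (hcard : Fintype.card ι = Fintype.card κ)
    (hA : ∀ Z, wedge (G Z) u = ∏ i, wedge Z (A i)) (hk : ∀ i, G (A i) = k i • u)
    (hB : ∀ Z, wedge (G Z) v = ∏ i, wedge Z (B i)) (hl : ∀ i, G (B i) = l i • v)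
    (huv : wedge u v ≠ 0) (h1 : ∏ i, ‖k i‖ = 1) : ∏ i, ‖l i‖ = 1 := by
  have e1 : ∏ i, ∏ j, ‖wedge (A i) (B j)‖ = (∏ i, ‖k i‖) * ‖wedge u v‖ ^ (Fintype.card ι) := by
    have : ∀ i, ∏ j, ‖wedge (A i) (B j)‖ = ‖k i‖ * ‖wedge u v‖ := by
      intro i
      rw [← norm_prod, ← hB, hk, wedge_smul_left, norm_mul]
    simp only [this, Finset.prod_mul_distrib]
    simp
  have e2 : ∏ i, ∏ j, ‖wedge (A i) (B j)‖ = (∏ i, ‖l i‖) * ‖wedge u v‖ ^ (Fintype.card κ) := by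
    have : ∀ j, ∏ i, ‖wedge (A i) (B j)‖ = ‖l j‖ * ‖wedge u v‖ := by
      intro j
      simp only [norm_wedge_comm _ (B j)]
      rw [← norm_prod, ← hA, hl, wedge_smul_left, norm_mul, norm_wedge_comm v u]
    rw [Finset.prod_comm]
    simp only [this, Finset.prod_mul_distrib]
    simp
  rw [e1, hcard, h1] at e2
  have hp : ‖wedge u v‖ ^ (Fintype.card κ) ≠ 0 := pow_ne_zero _ (norm_ne_zero_iff.mpr huv)
  exact (mul_right_cancel₀ hp e2).symm

variable {d : ℕ} {F₀ F₁ : MvPolynomial (Fin 2) ℂ}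

theorem good_base (hd : 2 ≤ d) (h₀ : F₀.IsHomogeneous d) (h₁ : F₁.IsHomogeneous d)
    (A : Fin d → ℂ × ℂ)
    (hfac : ∀ Z : ℂ × ℂ, ev F₀ Z = ∏ i, wedge Z (A i))
    (hres : ∏ i, ‖ev F₁ (A i)‖ = 1) : Good (Fmap F₀ F₁) d := by
  have split : ∀ u : ℂ × ℂ, u ≠ 0 → ∃ (B : Fin d → ℂ × ℂ) (k : Fin d → ℂ),
      (∀ Z, wedge (Fmap F₀ F₁ Z) u = ∏ i, wedge Z (B i)) ∧
      (∀ i, Fmap F₀ F₁ (B i) = k i • u) := by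
    intro u hu
    obtain ⟨B, hB⟩ := form_split (by omega : 1 ≤ d)
      (MvPolynomial.C u.2 * F₀ - MvPolynomial.C u.1 * F₁)
      ((h₀.C_mul _).sub (h₁.C_mul _))
    have hB' : ∀ Z, wedge (Fmap F₀ F₁ Z) u = ∏ i, wedge Z (B i) := by
      intro Z
      rw [← hB]
      simp [wedge, Fmap, ev]; ring
    have : ∀ i, ∃ k : ℂ, Fmap F₀ F₁ (B i) = k • u := by
      intro i
      apply exists_smul_of_wedge hu
      rw [hB']
      exact Finset.prod_eq_zero (Finset.mem_univ i) (wedge_self _)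
    choose k hk using this
    exact ⟨B, k, hB', hk⟩
  have hA' : ∀ Z, wedge (Fmap F₀ F₁ Z) (0, 1) = ∏ i, wedge Z (A i) := by
    intro Z; rw [← hfac]; simp [wedge, Fmap]
  have hkA : ∀ i, Fmap F₀ F₁ (A i) = ev F₁ (A i) • ((0, 1) : ℂ × ℂ) := by
    intro i
    have : ev F₀ (A i) = 0 := by
      rw [hfac]; exact Finset.prod_eq_zero (Finset.mem_univ i) (wedge_self _)
    simp [Fmap, this]
  have h10 : ((1, 0) : ℂ × ℂ) ≠ 0 := by simp
  obtain ⟨B₁, k₁, hB₁, hk₁⟩ := split (1, 0) h10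
  have g1 := good_switch rfl hA' hkA hB₁ hk₁ (by simp [wedge]) hres
  intro u hu
  obtain ⟨B, k, hB, hk⟩ := split u hu
  refine ⟨Fin d, inferInstance, B, k, by simp, hB, hk, ?_⟩
  by_cases h : u.1 = 0
  · refine good_switch rfl hB₁ hk₁ hB hk ?_ g1
    have : u.2 ≠ 0 := by
      intro h2; exact hu (Prod.ext h h2)
    simpa [wedge] using this
  · refine good_switch rfl hA' hkA hB hk ?_ hres
    simpa [wedge] using h

theorem good_iter (h₀ : F₀.IsHomogeneous d) (h₁ : F₁.IsHomogeneous d)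
    (hF : Good (Fmap F₀ F₁) d) (m : ℕ) : Good ((Fmap F₀ F₁)^[m]) (d ^ m) := by
  have F0 : ∀ (s : ℂ) Z, Fmap F₀ F₁ (s • Z) = s ^ d • Fmap F₀ F₁ Z := by
    intro s Z
    have := Fmap_iter_smul h₀ h₁ 1 s Z
    simpa using this
  induction m with
  | zero =>
    intro u hu
    exact ⟨Unit, inferInstance, fun _ => u, fun _ => 1, by simp, by simp, by simp, by simp⟩
  | succ m ih =>
    intro u hu
    obtain ⟨ι, _, A, k, hc, hA, hk, h1⟩ := hF u hu
    have hA0 : ∀ i, A i ≠ 0 := by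
      -- if some `A i = 0` the form vanishes identically, yet the values have product one
      intro i hi
      have hz : ∀ Z, wedge (Fmap F₀ F₁ Z) u = 0 := by
        intro Z; rw [hA]
        exact Finset.prod_eq_zero (Finset.mem_univ i) (by simp [hi, wedge])
      have hki : k i ≠ 0 := by
        intro h
        rw [Finset.prod_eq_zero (Finset.mem_univ i) (by simp [h])] at h1
        exact zero_ne_one h1
      have h0 := hk i
      rw [hi] at h0
      have h2 := F0 0 0
      by_cases hd0 : d = 0
      · haveI : Nonempty ι := ⟨i⟩
        have : Fintype.card ι ≠ 0 := Fintype.card_ne_zero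
        omega
      · rw [zero_pow hd0] at h2
        simp only [smul_zero, zero_smul] at h2
        rw [h2] at h0
        rcases smul_eq_zero.mp h0.symm with h | h
        · exact hki h
        · exact hu h
    choose κ fκ B l hc' hB hl h1' using fun i => ih (A i) (hA0 i)
    refine ⟨Σ i, κ i, inferInstance, fun x => B x.1 x.2, fun x => l x.1 x.2 ^ d * k x.1,
      ?_, ?_, ?_, ?_⟩
    · rw [Fintype.card_sigma]
      simp [hc', hc, pow_succ]; ring
    · intro Z
      rw [Function.iterate_succ_apply', hA, Fintype.prod_sigma]
      exact Finset.prod_congr rfl fun i _ => hB i Z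
    · rintro ⟨i, j⟩
      rw [Function.iterate_succ_apply', hl, F0, hk, smul_smul]
    · rw [Fintype.prod_sigma]
      simp only [norm_mul, norm_pow, Finset.prod_mul_distrib, Finset.prod_pow, h1',
        Finset.prod_const, Finset.card_univ, hc', one_pow, one_mul, h1]

theorem iter_ne_zero (hcz : ∀ Z : ℂ × ℂ, ev F₀ Z = 0 → ev F₁ Z = 0 → Z = 0) (m : ℕ)
    {Z : ℂ × ℂ} (hZ : Z ≠ 0) : (Fmap F₀ F₁)^[m] Z ≠ 0 := by
  induction m with
  | zero => simpa
  | succ m ih =>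
    rw [Function.iterate_succ_apply']
    intro h
    apply ih
    have := Prod.ext_iff.mp h
    exact hcz _ this.1 this.2

/-- no iterate is the identity -/
theorem Q_ne (hd : 2 ≤ d) (h₀ : F₀.IsHomogeneous d) (h₁ : F₁.IsHomogeneous d)
    (hcz : ∀ Z : ℂ × ℂ, ev F₀ Z = 0 → ev F₁ Z = 0 → Z = 0)
    (hF : Good (Fmap F₀ F₁) d) {m : ℕ} (hm : 1 ≤ m) :
    ∃ Z, wedge ((Fmap F₀ F₁)^[m] Z) Z ≠ 0 := by
  by_contra! H
  have hG := good_iter h₀ h₁ hF m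
  have hD : 2 ≤ d ^ m := hd.trans (Nat.le_self_pow (by omega) d)
  have key : ∀ u : ℂ × ℂ, u ≠ 0 → ∃ a : ℝ, a ≠ 0 ∧ ∀ Z, ‖wedge ((Fmap F₀ F₁)^[m] Z) u‖
      = a * ‖wedge Z u‖ ^ (d ^ m) := by
    intro u hu
    obtain ⟨ι, _, A, k, hc, hA, hk, h1⟩ := hG u hu
    have hki : ∀ i, k i ≠ 0 := by
      intro i h
      rw [Finset.prod_eq_zero (Finset.mem_univ i) (by simp [h])] at h1
      exact zero_ne_one h1
    have : ∀ i, ∃ s : ℂ, s ≠ 0 ∧ A i = s • u := by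
      intro i
      have h2 := H (A i)
      rw [hk, wedge_smul_left] at h2
      have h3 := (mul_eq_zero.mp h2).resolve_left (hki i)
      obtain ⟨s, hs⟩ := exists_smul_of_wedge (Z := A i) hu
        (by rw [← norm_eq_zero, norm_wedge_comm, h3, norm_zero])
      refine ⟨s, ?_, hs⟩
      rintro rfl
      rw [zero_smul] at hs
      have h4 := hk i
      have h5 := Fmap_iter_smul h₀ h₁ m 0 0
      rw [zero_pow (by positivity)] at h5
      simp only [smul_zero, zero_smul] at h5
      rw [hs, h5] at h4
      rcases smul_eq_zero.mp h4.symm with h | h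
      · exact hki i h
      · exact hu h
    choose s hs0 hs using this
    refine ⟨∏ i, ‖s i‖, Finset.prod_ne_zero_iff.mpr fun i _ => norm_ne_zero_iff.mpr (hs0 i), ?_⟩
    intro Z
    rw [hA, norm_prod]
    simp only [hs, wedge_smul_right, norm_mul, Finset.prod_mul_distrib, Finset.prod_const,
      Finset.card_univ, hc]
  obtain ⟨a, ha, hA⟩ := key (1, 0) (by simp)
  obtain ⟨b, hb, hB⟩ := key (0, 1) (by simp)
  have par : ∀ Z : ℂ × ℂ, Z ≠ 0 → ∃ c : ℂ, (Fmap F₀ F₁)^[m] Z = c • Z := fun Z hZ =>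
    exists_smul_of_wedge hZ (H Z)
  obtain ⟨c, hc⟩ := par (1, 1) (by simp)
  obtain ⟨e, he⟩ := par (1, 2) (by simp)
  have a1 := hA (1, 1)
  have a2 := hA (1, 2)
  have b1 := hB (1, 1)
  have b2 := hB (1, 2)
  rw [hc] at a1 b1
  rw [he] at a2 b2
  simp [wedge] at a1 a2 b1 b2
  have hab : a = b := by rw [← a1, ← b1]
  rw [b2, hab] at a2
  have h6 : (2 : ℝ) = 2 ^ d ^ m := mul_left_cancel₀ hb a2
  have h7 : (2 : ℝ) ^ 2 ≤ 2 ^ d ^ m := pow_le_pow_right₀ (by norm_num) hD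
  rw [← h6] at h7
  norm_num at h7

theorem iter_periodic (h₀ : F₀.IsHomogeneous d) (h₁ : F₁.IsHomogeneous d)
    {m : ℕ} {Z : ℂ × ℂ} {c : ℂ} (h : (Fmap F₀ F₁)^[m] Z = c • Z) (k : ℕ) :
    ∃ e : ℕ, (1 ≤ k → 1 ≤ e) ∧ (Fmap F₀ F₁)^[m * k] Z = c ^ e • Z := by
  induction k with
  | zero => exact ⟨0, by simp, by simp⟩
  | succ k ih =>
    obtain ⟨e, he, ih⟩ := ih
    refine ⟨e * d ^ m + 1, by simp, ?_⟩
    rw [mul_add, mul_one, add_comm, Function.iterate_add_apply, ih, Fmap_iter_smul h₀ h₁, h,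
      smul_smul, pow_succ, pow_mul]

theorem gam_exists (hd : 2 ≤ d) (h₀ : F₀.IsHomogeneous d) (h₁ : F₁.IsHomogeneous d)
    (hcz : ∀ Z : ℂ × ℂ, ev F₀ Z = 0 → ev F₁ Z = 0 → Z = 0)
    {Z : ℂ × ℂ} (hZ : Z ≠ 0) {m₀ : ℕ} (hm₀ : 1 ≤ m₀)
    (hw : wedge ((Fmap F₀ F₁)^[m₀] Z) Z = 0) :
    ∃ x : ℝ, 0 < x ∧ ∀ m, 1 ≤ m → ∀ c : ℂ, (Fmap F₀ F₁)^[m] Z = c • Z →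
      ‖c‖ = x ^ (d ^ m - 1) := by
  obtain ⟨c₀, hc₀⟩ := exists_smul_of_wedge hZ hw
  have hc0 : c₀ ≠ 0 := by
    rintro rfl
    exact iter_ne_zero hcz m₀ hZ (by rw [hc₀, zero_smul])
  have hD : 2 ≤ d ^ m₀ := hd.trans (Nat.le_self_pow (by omega) d)
  obtain ⟨t, ht⟩ := IsAlgClosed.exists_pow_nat_eq c₀⁻¹ (n := d ^ m₀ - 1) (by omega)
  have ht0 : t ≠ 0 := by
    rintro rfl
    rw [zero_pow (by omega)] at ht
    exact inv_ne_zero hc0 ht.symm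
  have hZ' : (Fmap F₀ F₁)^[m₀] (t • Z) = (1 : ℂ) • (t • Z) := by
    rw [Fmap_iter_smul h₀ h₁, hc₀, smul_smul, one_smul]
    congr 1
    obtain ⟨E, hE⟩ : ∃ E, d ^ m₀ = E + 1 := ⟨d ^ m₀ - 1, by omega⟩
    rw [hE] at ht ⊢
    simp at ht
    rw [pow_succ, ht]; field_simp
  have htZ : t • Z ≠ 0 := smul_ne_zero ht0 hZ
  refine ⟨‖t‖⁻¹, by positivity, fun m hm c hc => ?_⟩
  have hDm : 2 ≤ d ^ m := hd.trans (Nat.le_self_pow (by omega) d)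
  obtain ⟨E, hE⟩ : ∃ E, d ^ m = E + 1 := ⟨d ^ m - 1, by omega⟩
  have h3 : (Fmap F₀ F₁)^[m] (t • Z) = (t ^ E * c) • (t • Z) := by
    rw [Fmap_iter_smul h₀ h₁, hc, smul_smul, smul_smul, hE]
    congr 1; ring
  obtain ⟨e, he, h4⟩ := iter_periodic h₀ h₁ h3 m₀
  obtain ⟨e', -, h5⟩ := iter_periodic h₀ h₁ hZ' m
  rw [mul_comm, h4, one_pow] at h5
  have h6 := smul_left_injective ℂ htZ h5
  have h7 : ‖t ^ E * c‖ = 1 := by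
    have := congrArg norm h6
    rw [norm_pow, norm_one] at this
    exact (pow_eq_one_iff_of_nonneg (norm_nonneg _) (by have := he hm₀; omega)).mp this
  rw [hE]
  rw [norm_mul, norm_pow] at h7
  simp
  field_simp
  linear_combination h7

open Classical in
/-- the exponential of the Green function at a periodic point -/
noncomputable def gam (d : ℕ) (F₀ F₁ : MvPolynomial (Fin 2) ℂ) (Z : ℂ × ℂ) : ℝ :=
  if h : ∃ x : ℝ, 0 < x ∧ ∀ m, 1 ≤ m → ∀ c : ℂ, (Fmap F₀ F₁)^[m] Z = c • Z →
      ‖c‖ = x ^ (d ^ m - 1) then h.choose else 1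

theorem gam_pos (Z : ℂ × ℂ) : 0 < gam d F₀ F₁ Z := by
  unfold gam
  split_ifs with h
  · exact h.choose_spec.1
  · exact one_pos

theorem gam_spec (hd : 2 ≤ d) (h₀ : F₀.IsHomogeneous d) (h₁ : F₁.IsHomogeneous d)
    (hcz : ∀ Z : ℂ × ℂ, ev F₀ Z = 0 → ev F₁ Z = 0 → Z = 0)
    {Z : ℂ × ℂ} (hZ : Z ≠ 0) {m : ℕ} (hm : 1 ≤ m) {c : ℂ}
    (hc : (Fmap F₀ F₁)^[m] Z = c • Z) : ‖c‖ = gam d F₀ F₁ Z ^ (d ^ m - 1) := by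
  have h := gam_exists hd h₀ h₁ hcz hZ hm (by rw [hc, wedge_smul_left, wedge_self, mul_zero])
  unfold gam
  rw [dif_pos h]
  exact h.choose_spec.2 m hm c hc

theorem gam_smul (hd : 2 ≤ d) (h₀ : F₀.IsHomogeneous d) (h₁ : F₁.IsHomogeneous d)
    (hcz : ∀ Z : ℂ × ℂ, ev F₀ Z = 0 → ev F₁ Z = 0 → Z = 0)
    {Z : ℂ × ℂ} (hZ : Z ≠ 0) {m : ℕ} (hm : 1 ≤ m)
    (hw : wedge ((Fmap F₀ F₁)^[m] Z) Z = 0) {t : ℂ} (ht : t ≠ 0) :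
    gam d F₀ F₁ (t • Z) = ‖t‖ * gam d F₀ F₁ Z := by
  obtain ⟨c, hc⟩ := exists_smul_of_wedge hZ hw
  have hDm : 2 ≤ d ^ m := hd.trans (Nat.le_self_pow (by omega) d)
  obtain ⟨E, hE⟩ : ∃ E, d ^ m = E + 1 := ⟨d ^ m - 1, by omega⟩
  have h3 : (Fmap F₀ F₁)^[m] (t • Z) = (t ^ E * c) • (t • Z) := by
    rw [Fmap_iter_smul h₀ h₁, hc, smul_smul, smul_smul, hE]
    congr 1; ring
  have a := gam_spec hd h₀ h₁ hcz hZ hm hc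
  have b := gam_spec hd h₀ h₁ hcz (smul_ne_zero ht hZ) hm h3
  rw [norm_mul, norm_pow, a, hE, Nat.add_sub_cancel, ← mul_pow] at b
  have hg := gam_pos (d := d) (F₀ := F₀) (F₁ := F₁) Z
  exact ((pow_left_inj₀ (n := E) (by positivity) (gam_pos _).le (by omega)).mp b).symm

theorem gam_prod (hd : 2 ≤ d) (h₀ : F₀.IsHomogeneous d) (h₁ : F₁.IsHomogeneous d)
    (hcz : ∀ Z : ℂ × ℂ, ev F₀ Z = 0 → ev F₁ Z = 0 → Z = 0)
    (hF : Good (Fmap F₀ F₁) d) {m : ℕ} (hm : 1 ≤ m) {ι : Type} (s : Finset ι) (W : ι → ℂ × ℂ)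
    (hW : ∀ Z, wedge ((Fmap F₀ F₁)^[m] Z) Z = ∏ i ∈ s, wedge Z (W i)) :
    (∀ i ∈ s, W i ≠ 0) ∧ ∏ i ∈ s, gam d F₀ F₁ (W i) = 1 := by
  obtain ⟨u, hu⟩ := Q_ne hd h₀ h₁ hcz hF hm
  have hW0 : ∀ i ∈ s, W i ≠ 0 := by
    intro i hi h
    apply hu
    rw [hW]
    exact Finset.prod_eq_zero hi (by simp [h, wedge])
  refine ⟨hW0, ?_⟩
  have hu0 : u ≠ 0 := by
    rintro rfl; exact hu (by simp [wedge])
  have : ∀ i, ∃ c : ℂ, i ∈ s → (Fmap F₀ F₁)^[m] (W i) = c • W i := by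
    intro i
    by_cases hi : i ∈ s
    · obtain ⟨c, hc⟩ := exists_smul_of_wedge (Z := (Fmap F₀ F₁)^[m] (W i)) (hW0 i hi)
        (by rw [hW]; exact Finset.prod_eq_zero hi (wedge_self _))
      exact ⟨c, fun _ => hc⟩
    · exact ⟨0, fun h => absurd h hi⟩
  choose c hc using this
  obtain ⟨κ, _, A, k, hcard, hA, hk, h1⟩ := good_iter h₀ h₁ hF m u hu0
  have e1 : ∏ j ∈ s, ∏ i, ‖wedge (W j) (A i)‖
      = (∏ j ∈ s, ‖c j‖) * ‖wedge ((Fmap F₀ F₁)^[m] u) u‖ := by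
    rw [hW u, norm_prod, ← Finset.prod_mul_distrib]
    refine Finset.prod_congr rfl fun j hj => ?_
    rw [← norm_prod, ← hA, hc j hj, wedge_smul_left, norm_mul, norm_wedge_comm (W j)]
  have e2 : ∏ j ∈ s, ∏ i, ‖wedge (W j) (A i)‖
      = (∏ i, ‖k i‖) * ‖wedge ((Fmap F₀ F₁)^[m] u) u‖ := by
    rw [hA u, norm_prod, ← Finset.prod_mul_distrib, Finset.prod_comm]
    refine Finset.prod_congr rfl fun i _ => ?_
    simp only [norm_wedge_comm _ (A i)]
    rw [← norm_prod, ← hW, hk, wedge_smul_left, norm_mul, norm_wedge_comm u]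
  have h3 : ∏ j ∈ s, ‖c j‖ = 1 := by
    rw [e1, h1] at e2
    exact mul_right_cancel₀ (norm_ne_zero_iff.mpr hu) e2
  have h4 : (∏ i ∈ s, gam d F₀ F₁ (W i)) ^ (d ^ m - 1) = 1 := by
    rw [← Finset.prod_pow, ← h3]
    exact Finset.prod_congr rfl fun j hj =>
      (gam_spec hd h₀ h₁ hcz (hW0 j hj) hm (hc j hj)).symm
  have hDm : 2 ≤ d ^ m := hd.trans (Nat.le_self_pow (by omega) d)
  exact (pow_eq_one_iff_of_nonneg (Finset.prod_nonneg fun i _ => (gam_pos _).le)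
    (by omega)).mp h4

end Gamma

section Chart

/-- the generic point of the affine line `u + w v` -/
noncomputable def eP (u v : ℂ × ℂ) : Polynomial ℂ × Polynomial ℂ :=
  (Polynomial.C u.1 + Polynomial.C v.1 * Polynomial.X,
    Polynomial.C u.2 + Polynomial.C v.2 * Polynomial.X)

/-- the iterate along the line -/
noncomputable def pP (F₀ F₁ : MvPolynomial (Fin 2) ℂ) (u v : ℂ × ℂ) (m : ℕ) :
    Polynomial ℂ × Polynomial ℂ := (FS F₀ F₁)^[m] (eP u v)

/-- `F^m(e) ∧ e` along the line -/
noncomputable def qP (F₀ F₁ : MvPolynomial (Fin 2) ℂ) (u v : ℂ × ℂ) (m : ℕ) :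
    Polynomial ℂ := wS (pP F₀ F₁ u v m) (eP u v)

/-- `F^m(e) ∧ v` along the line -/
noncomputable def PP (F₀ F₁ : MvPolynomial (Fin 2) ℂ) (u v : ℂ × ℂ) (m : ℕ) :
    Polynomial ℂ := wS (pP F₀ F₁ u v m) (Polynomial.C v.1, Polynomial.C v.2)

variable {d : ℕ} {F₀ F₁ : MvPolynomial (Fin 2) ℂ} {u v : ℂ × ℂ}

theorem eP_eval (w : ℂ) : ((eP u v).1.eval w, (eP u v).2.eval w) = u + w • v := by
  ext <;> simp [eP] <;> ring

theorem pP_eval (m : ℕ) (w : ℂ) : ((pP F₀ F₁ u v m).1.eval w, (pP F₀ F₁ u v m).2.eval w)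
    = (Fmap F₀ F₁)^[m] (u + w • v) := by
  have := FS_iter_map F₀ F₁ (Polynomial.aeval w : Polynomial ℂ →ₐ[ℂ] ℂ) m (eP u v)
  simp only [Polynomial.coe_aeval_eq_eval] at this
  rw [eP_eval, FS_eq_Fmap] at this
  rw [this]; rfl

theorem qP_eval (m : ℕ) (w : ℂ) : (qP F₀ F₁ u v m).eval w
    = wedge ((Fmap F₀ F₁)^[m] (u + w • v)) (u + w • v) := by
  rw [← pP_eval, ← eP_eval]
  simp [qP, wS, wedge]

theorem PP_eval (m : ℕ) (w : ℂ) : (PP F₀ F₁ u v m).eval w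
    = wedge ((Fmap F₀ F₁)^[m] (u + w • v)) v := by
  rw [← pP_eval]
  simp [PP, wS, wedge]

theorem wedge_line (huv : wedge u v = 1) (w : ℂ) : wedge (u + w • v) v = 1 := by
  rw [← huv]; simp [wedge]; ring

theorem line_ne (huv : wedge u v = 1) (w : ℂ) : u + w • v ≠ 0 := by
  intro h
  have := wedge_line huv w
  rw [h, wedge_zero_left] at this
  exact zero_ne_one this

theorem C_huv (huv : wedge u v = 1) : Polynomial.C u.1 * Polynomial.C v.2 -
    Polynomial.C u.2 * Polynomial.C v.1 = 1 := by
  rw [← Polynomial.C_mul, ← Polynomial.C_mul, ← Polynomial.C_sub]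
  have : u.1 * v.2 - u.2 * v.1 = 1 := huv
  rw [this, Polynomial.C_1]

theorem pP_decomp1 (huv : wedge u v = 1) (m : ℕ) : (pP F₀ F₁ u v m).1 =
    PP F₀ F₁ u v m * (eP u v).1 - qP F₀ F₁ u v m * Polynomial.C v.1 := by
  have := C_huv huv
  simp only [PP, qP, wS, eP]
  linear_combination (-(pP F₀ F₁ u v m).1) * this

theorem pP_decomp2 (huv : wedge u v = 1) (m : ℕ) : (pP F₀ F₁ u v m).2 =
    PP F₀ F₁ u v m * (eP u v).2 - qP F₀ F₁ u v m * Polynomial.C v.2 := by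
  have := C_huv huv
  simp only [PP, qP, wS, eP]
  linear_combination (-(pP F₀ F₁ u v m).2) * this

theorem q_add (h₀ : F₀.IsHomogeneous d) (h₁ : F₁.IsHomogeneous d) (huv : wedge u v = 1)
    (a b : ℕ) : qP F₀ F₁ u v b ∣
      qP F₀ F₁ u v (a + b) - PP F₀ F₁ u v b ^ (d ^ a) * qP F₀ F₁ u v a := by
  set q := qP F₀ F₁ u v b with hq
  set I := Ideal.span {q}
  let φ : Polynomial ℂ →ₐ[ℂ] (Polynomial ℂ ⧸ I) := Ideal.Quotient.mkₐ ℂ I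
  have hφ : ∀ f, φ f = 0 ↔ q ∣ f := by
    intro f
    change Ideal.Quotient.mk I f = 0 ↔ _
    rw [Ideal.Quotient.eq_zero_iff_mem, Ideal.mem_span_singleton]
  have hφq : φ q = 0 := (hφ q).mpr dvd_rfl
  have e1 := FS_iter_map F₀ F₁ φ a (pP F₀ F₁ u v b)
  have e2 := FS_iter_map F₀ F₁ φ a (eP u v)
  have e3 : (φ (pP F₀ F₁ u v b).1, φ (pP F₀ F₁ u v b).2)
      = φ (PP F₀ F₁ u v b) • (φ (eP u v).1, φ (eP u v).2) := by
    rw [pP_decomp1 huv b, pP_decomp2 huv b, ← hq]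
    simp [hφq]
  rw [e3, FS_iter_smul h₀ h₁, e2] at e1
  have e4 : (FS F₀ F₁)^[a] (pP F₀ F₁ u v b) = pP F₀ F₁ u v (a + b) := by
    simp only [pP]; rw [Function.iterate_add_apply]
  rw [e4] at e1
  have e5 : (FS F₀ F₁)^[a] (eP u v) = pP F₀ F₁ u v a := rfl
  rw [e5] at e1
  obtain ⟨f1, f2⟩ := Prod.ext_iff.mp e1
  simp only [Prod.smul_fst, Prod.smul_snd, smul_eq_mul] at f1 f2
  rw [← hφ]
  simp only [qP, wS, map_sub, map_mul, map_pow]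
  linear_combination (-φ (eP u v).2) * f1 + φ (eP u v).1 * f2

theorem q_dvd (h₀ : F₀.IsHomogeneous d) (h₁ : F₁.IsHomogeneous d) (huv : wedge u v = 1)
    (g k : ℕ) : qP F₀ F₁ u v g ∣ qP F₀ F₁ u v (g * k) := by
  induction k with
  | zero =>
    have : qP F₀ F₁ u v (g * 0) = 0 := by simp [qP, pP, wS]; ring
    rw [this]; exact dvd_zero _
  | succ k ih =>
    rw [mul_add, mul_one]
    have := q_add (F₀ := F₀) (F₁ := F₁) h₀ h₁ huv (g * k) g
    have h2 := dvd_add this (ih.mul_left (PP F₀ F₁ u v g ^ d ^ (g * k)))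
    simpa using h2

theorem PP_qP_coprime (hcz : ∀ Z : ℂ × ℂ, ev F₀ Z = 0 → ev F₁ Z = 0 → Z = 0)
    (huv : wedge u v = 1) (b : ℕ) : IsCoprime (PP F₀ F₁ u v b) (qP F₀ F₁ u v b) := by
  rw [Polynomial.isCoprime_iff_aeval_ne_zero_of_isAlgClosed ℂ ℂ]
  intro w
  by_contra! h
  simp only [Polynomial.coe_aeval_eq_eval] at h
  have h1 := congrArg (Polynomial.eval w) (pP_decomp1 (F₀ := F₀) (F₁ := F₁) huv b)
  have h2 := congrArg (Polynomial.eval w) (pP_decomp2 (F₀ := F₀) (F₁ := F₁) huv b)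
  simp only [Polynomial.eval_sub, Polynomial.eval_mul, h.1, h.2, zero_mul, sub_zero] at h1 h2
  have h3 := pP_eval (F₀ := F₀) (F₁ := F₁) (u := u) (v := v) b w
  rw [h1, h2] at h3
  exact iter_ne_zero hcz b (line_ne huv w) h3.symm

theorem q_add_sq (h₀ : F₀.IsHomogeneous d) (h₁ : F₁.IsHomogeneous d)
    (hcz : ∀ Z : ℂ × ℂ, ev F₀ Z = 0 → ev F₁ Z = 0 → Z = 0) (huv : wedge u v = 1)
    (a b : ℕ) : qP F₀ F₁ u v b ^ 2 ∣
      PP F₀ F₁ u v b * qP F₀ F₁ u v (a + b) - PP F₀ F₁ u v b ^ (d ^ a) *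
        (PP F₀ F₁ u v b * qP F₀ F₁ u v a - qP F₀ F₁ u v b *
          (Polynomial.derivative (qP F₀ F₁ u v a) - PP F₀ F₁ u v a)) := by
  set q := qP F₀ F₁ u v b with hq
  set I := Ideal.span {q ^ 2}
  let φ : Polynomial ℂ →ₐ[ℂ] (Polynomial ℂ ⧸ I) := Ideal.Quotient.mkₐ ℂ I
  have hφ : ∀ f, φ f = 0 ↔ q ^ 2 ∣ f := by
    intro f
    change Ideal.Quotient.mk I f = 0 ↔ _
    rw [Ideal.Quotient.eq_zero_iff_mem, Ideal.mem_span_singleton]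
  have hφq : φ q ^ 2 = 0 := by rw [← map_pow]; exact (hφ _).mpr dvd_rfl
  obtain ⟨s, t, hst⟩ := (PP_qP_coprime hcz huv b).pow_right (n := 2)
  have hinv : φ (PP F₀ F₁ u v b) * φ s = 1 := by
    have := congrArg φ hst
    rw [← hq] at this
    rw [map_add, map_mul, map_mul, map_pow, hφq, mul_zero, add_zero, map_one, mul_comm] at this
    exact this
  set y := -(φ q * φ s) with hy
  have hy2 : y ^ 2 = 0 := by rw [hy]; linear_combination (φ s) ^ 2 * hφq
  let ψ : Polynomial ℂ →ₐ[ℂ] (Polynomial ℂ ⧸ I) := Polynomial.aeval (φ Polynomial.X + y)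
  have hφX : ∀ f, Polynomial.aeval (φ Polynomial.X) f = φ f := by
    intro f
    rw [Polynomial.aeval_algHom_apply, Polynomial.aeval_X_left_apply]
  have hψ : ∀ f, ψ f = φ f + φ (Polynomial.derivative f) * y := by
    intro f
    change Polynomial.aeval _ f = _
    rw [Polynomial.aeval_add_of_sq_eq_zero _ _ _ hy2, hφX, hφX]
  have e1 := FS_iter_map F₀ F₁ φ a (pP F₀ F₁ u v b)
  have e2 := FS_iter_map F₀ F₁ ψ a (eP u v)
  have d1 : Polynomial.derivative (eP u v).1 = Polynomial.C v.1 := by simp [eP]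
  have d2 : Polynomial.derivative (eP u v).2 = Polynomial.C v.2 := by simp [eP]
  have e3 : (φ (pP F₀ F₁ u v b).1, φ (pP F₀ F₁ u v b).2)
      = φ (PP F₀ F₁ u v b) • (ψ (eP u v).1, ψ (eP u v).2) := by
    rw [pP_decomp1 huv b, pP_decomp2 huv b, ← hq, hψ, hψ, d1, d2]
    ext
    · simp only [map_sub, map_mul, Prod.smul_fst, smul_eq_mul, hy]
      linear_combination φ (Polynomial.C v.1) * φ q * hinv
    · simp only [map_sub, map_mul, Prod.smul_snd, smul_eq_mul, hy]
      linear_combination φ (Polynomial.C v.2) * φ q * hinv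
  rw [e3, FS_iter_smul h₀ h₁, e2] at e1
  have e4 : (FS F₀ F₁)^[a] (pP F₀ F₁ u v b) = pP F₀ F₁ u v (a + b) := by
    simp only [pP]; rw [Function.iterate_add_apply]
  rw [e4] at e1
  have e5 : (FS F₀ F₁)^[a] (eP u v) = pP F₀ F₁ u v a := rfl
  rw [e5, hψ, hψ] at e1
  obtain ⟨f1, f2⟩ := Prod.ext_iff.mp e1
  simp only [Prod.smul_fst, Prod.smul_snd, smul_eq_mul] at f1 f2
  have dq : Polynomial.derivative (qP F₀ F₁ u v a) - PP F₀ F₁ u v a =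
      Polynomial.derivative (pP F₀ F₁ u v a).1 * (eP u v).2 -
      Polynomial.derivative (pP F₀ F₁ u v a).2 * (eP u v).1 := by
    simp only [qP, PP, wS, Polynomial.derivative_sub, Polynomial.derivative_mul, d1, d2]
    ring
  rw [← hφ, dq]
  have qa : ∀ m, φ (qP F₀ F₁ u v m) = φ (pP F₀ F₁ u v m).1 * φ (eP u v).2 -
    φ (pP F₀ F₁ u v m).2 * φ (eP u v).1 := by intro m; simp [qP, wS]
  simp only [map_sub, map_mul, map_pow, qa]
  rw [hy] at f1 f2
  generalize φ (PP F₀ F₁ u v b) = P at *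
  linear_combination (-P * φ (eP u v).2) * f1 + P * φ (eP u v).1 * f2 +
    P ^ d ^ a * φ q * (φ (Polynomial.derivative (pP F₀ F₁ u v a).2) * φ (eP u v).1 -
      φ (Polynomial.derivative (pP F₀ F₁ u v a).1) * φ (eP u v).2) * hinv

theorem root_eigen (huv : wedge u v = 1) {g : ℕ} {w : ℂ}
    (hw : (qP F₀ F₁ u v g).eval w = 0) :
    (Fmap F₀ F₁)^[g] (u + w • v) = (PP F₀ F₁ u v g).eval w • (u + w • v) := by
  have h1 := congrArg (Polynomial.eval w) (pP_decomp1 (F₀ := F₀) (F₁ := F₁) huv g)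
  have h2 := congrArg (Polynomial.eval w) (pP_decomp2 (F₀ := F₀) (F₁ := F₁) huv g)
  simp only [Polynomial.eval_sub, Polynomial.eval_mul, hw, zero_mul, sub_zero] at h1 h2
  rw [← pP_eval, ← eP_eval, h1, h2]
  simp

theorem root_PP_ne (hcz : ∀ Z : ℂ × ℂ, ev F₀ Z = 0 → ev F₁ Z = 0 → Z = 0)
    (huv : wedge u v = 1) {g : ℕ} {w : ℂ}
    (hw : (qP F₀ F₁ u v g).eval w = 0) : (PP F₀ F₁ u v g).eval w ≠ 0 := by
  intro h
  have := root_eigen huv hw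
  rw [h, zero_smul] at this
  exact iter_ne_zero hcz g (line_ne huv w) this

/-- multiplier in the chart -/
noncomputable def Lam (F₀ F₁ : MvPolynomial (Fin 2) ℂ) (u v : ℂ × ℂ) (g : ℕ) (w : ℂ) : ℂ :=
  1 - (Polynomial.derivative (qP F₀ F₁ u v g)).eval w / (PP F₀ F₁ u v g).eval w

theorem T_exists (h₀ : F₀.IsHomogeneous d) (h₁ : F₁.IsHomogeneous d)
    (hcz : ∀ Z : ℂ × ℂ, ev F₀ Z = 0 → ev F₁ Z = 0 → Z = 0) (huv : wedge u v = 1)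
    {g : ℕ} (hq0 : qP F₀ F₁ u v g ≠ 0) {w : ℂ} (hw : (qP F₀ F₁ u v g).eval w = 0)
    {k : ℕ} (hk : 1 ≤ k) :
    ∃ T : Polynomial ℂ, qP F₀ F₁ u v (g * k) = qP F₀ F₁ u v g * T ∧
      T.eval w * (PP F₀ F₁ u v g).eval w =
        (PP F₀ F₁ u v (g * k)).eval w * ∑ i ∈ Finset.range k, Lam F₀ F₁ u v g w ^ i := by
  induction k, hk using Nat.le_induction with
  | base => exact ⟨1, by simp, by simp⟩
  | succ k hk ih =>
    obtain ⟨T, hT, hTe⟩ := ih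
    obtain ⟨T', hT'⟩ := q_dvd (F₀ := F₀) (F₁ := F₁) h₀ h₁ huv g (k + 1)
    refine ⟨T', hT', ?_⟩
    have h := q_add_sq h₀ h₁ hcz huv (g * k) g
    have hgk : g * k + g = g * (k + 1) := by ring
    rw [hgk, hT, hT'] at h
    set q := qP F₀ F₁ u v g
    set P := PP F₀ F₁ u v g
    have h2 : q ^ 2 ∣ q * (P * T' - P ^ d ^ (g * k) * (P * T - (Polynomial.derivative q * T
        + q * Polynomial.derivative T - PP F₀ F₁ u v (g * k)))) := by
      convert h using 1
      rw [Polynomial.derivative_mul]; ring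
    rw [pow_two] at h2
    obtain ⟨r, hr⟩ := (mul_dvd_mul_iff_left hq0).mp h2
    have h3 := congrArg (Polynomial.eval w) hr
    simp only [Polynomial.eval_sub, Polynomial.eval_mul, Polynomial.eval_add, hw, zero_mul,
      Polynomial.eval_pow] at h3
    have hc : P.eval w ≠ 0 := root_PP_ne hcz huv hw
    have hPadd : (PP F₀ F₁ u v (g * (k + 1))).eval w =
        P.eval w ^ d ^ (g * k) * (PP F₀ F₁ u v (g * k)).eval w := by
      rw [← hgk, PP_eval, Function.iterate_add_apply, root_eigen huv hw, Fmap_iter_smul h₀ h₁,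
        wedge_smul_left, ← PP_eval]
    have hL : P.eval w * Lam F₀ F₁ u v g w = P.eval w - (Polynomial.derivative q).eval w := by
      unfold Lam
      change P.eval w * (1 - (Polynomial.derivative q).eval w / P.eval w) = _
      field_simp
    rw [geom_sum_succ, hPadd]
    linear_combination h3 + P.eval w ^ d ^ (g * k) * (-T.eval w * hL +
       Lam F₀ F₁ u v g w * hTe)

theorem Lam_pow (h₀ : F₀.IsHomogeneous d) (h₁ : F₁.IsHomogeneous d)
    (hcz : ∀ Z : ℂ × ℂ, ev F₀ Z = 0 → ev F₁ Z = 0 → Z = 0) (huv : wedge u v = 1)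
    {g : ℕ} (hq0 : qP F₀ F₁ u v g ≠ 0) {w : ℂ} (hw : (qP F₀ F₁ u v g).eval w = 0)
    {k : ℕ} (hk : 1 ≤ k) : Lam F₀ F₁ u v (g * k) w = Lam F₀ F₁ u v g w ^ k := by
  obtain ⟨T, hT, hTe⟩ := T_exists h₀ h₁ hcz huv hq0 hw hk
  have hw' : (qP F₀ F₁ u v (g * k)).eval w = 0 := by rw [hT]; simp [hw]
  have hc := root_PP_ne hcz huv hw
  have hc' := root_PP_ne hcz huv hw'
  have hS := geom_sum_mul (Lam F₀ F₁ u v g w) k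
  have e1 : (Polynomial.derivative (qP F₀ F₁ u v (g * k))).eval w =
      (Polynomial.derivative (qP F₀ F₁ u v g)).eval w * T.eval w := by
    rw [hT, Polynomial.derivative_mul]; simp [hw]
  have hL : (PP F₀ F₁ u v g).eval w * (1 - Lam F₀ F₁ u v g w)
      = (Polynomial.derivative (qP F₀ F₁ u v g)).eval w := by
    unfold Lam
    field_simp
    ring
  have : Lam F₀ F₁ u v (g * k) w = 1 - (Polynomial.derivative (qP F₀ F₁ u v g)).eval w * T.eval w
      / (PP F₀ F₁ u v (g * k)).eval w := by
    rw [← e1]; rfl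
  rw [this, ← hL]
  field_simp
  linear_combination (-(1 - Lam F₀ F₁ u v g w)) * hTe - (PP F₀ F₁ u v (g * k)).eval w * hS * (-1)

end Chart

section Incomparable

variable {d : ℕ} {F₀ F₁ : MvPolynomial (Fin 2) ℂ} {u v : ℂ × ℂ}

/-- the linear form `e ∧ W` in the chart -/
noncomputable def lf (u v W : ℂ × ℂ) : Polynomial ℂ :=
  Polynomial.C (wedge v W) * Polynomial.X + Polynomial.C (wedge u W)

theorem lf_eval (W : ℂ × ℂ) (w : ℂ) : (lf u v W).eval w = wedge (u + w • v) W := by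
  simp [lf, wedge]; ring

/-- absolute value of the resultant -/
noncomputable def RR (p q : Polynomial ℂ) : ℝ := ‖Polynomial.resultant p q‖

theorem RR_symm (p q : Polynomial ℂ) : RR p q = RR q p := by
  unfold RR
  rw [Polynomial.resultant_comm]
  simp

theorem RR_eval (p q : Polynomial ℂ) : RR p q =
    ‖p.leadingCoeff‖ ^ q.natDegree * (p.roots.map fun x => ‖q.eval x‖).prod := by
  unfold RR
  rw [Polynomial.resultant_eq_prod_eval p q _ le_rfl (IsAlgClosed.splits p), norm_mul, norm_pow]
  congr 1
  have := map_multiset_prod (normHom : ℂ →*₀ ℝ) (p.roots.map q.eval)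
  simp only [Multiset.map_map] at this
  exact this

theorem RR_prod_left {ι : Type} (s : Finset ι) (f : ι → Polynomial ℂ) (g : Polynomial ℂ)
    (hf : ∀ i ∈ s, f i ≠ 0) : RR (∏ i ∈ s, f i) g = ∏ i ∈ s, RR (f i) g := by
  unfold RR
  rw [Polynomial.resultant_prod_left s f g _ _ le_rfl, norm_prod]
  rw [Finset.prod_ne_zero_iff]
  intro i hi
  exact Polynomial.leadingCoeff_ne_zero.mpr (hf i hi)

theorem RR_prod_right {ι : Type} (s : Finset ι) (f : ι → Polynomial ℂ) (g : Polynomial ℂ)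
    (hf : ∀ i ∈ s, f i ≠ 0) : RR g (∏ i ∈ s, f i) = ∏ i ∈ s, RR g (f i) := by
  rw [RR_symm, RR_prod_left s f g hf]
  exact Finset.prod_congr rfl fun i _ => RR_symm _ _

/-- the local height of a polynomial -/
noncomputable def Gam (d : ℕ) (F₀ F₁ : MvPolynomial (Fin 2) ℂ) (u v : ℂ × ℂ) (p : Polynomial ℂ) :
    ℝ := ‖p.leadingCoeff‖ * (p.roots.map fun x => gam d F₀ F₁ (u + x • v)).prod

theorem Gam_mul {p q : Polynomial ℂ} (hp : p ≠ 0) (hq : q ≠ 0) :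
    Gam d F₀ F₁ u v (p * q) = Gam d F₀ F₁ u v p * Gam d F₀ F₁ u v q := by
  unfold Gam
  rw [Polynomial.leadingCoeff_mul, Polynomial.roots_mul (mul_ne_zero hp hq), norm_mul,
    Multiset.map_add, Multiset.prod_add]
  ring

theorem Gam_prod {ι : Type} (s : Finset ι) (f : ι → Polynomial ℂ)
    (hf : ∀ i ∈ s, f i ≠ 0) : Gam d F₀ F₁ u v (∏ i ∈ s, f i) = ∏ i ∈ s, Gam d F₀ F₁ u v (f i) := by
  classical
  induction s using Finset.induction with
  | empty => simp [Gam]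
  | insert i s hi ih =>
    rw [Finset.prod_insert hi, Finset.prod_insert hi, Gam_mul (hf i (by simp)), ih]
    · intro j hj; exact hf j (by simp [hj])
    · rw [Finset.prod_ne_zero_iff]; intro j hj; exact hf j (by simp [hj])

theorem lf_ne {W : ℂ × ℂ} (h : wedge v W ≠ 0) : lf u v W ≠ 0 := by
  intro h0
  have := Polynomial.leadingCoeff_linear (b := wedge u W) h
  change (lf u v W).leadingCoeff = _ at this
  rw [h0] at this
  simp at this
  exact h this.symm

theorem lf_deg {W : ℂ × ℂ} (h : wedge v W ≠ 0) : (lf u v W).natDegree = 1 :=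
  Polynomial.natDegree_linear h

theorem lf_lc {W : ℂ × ℂ} (h : wedge v W ≠ 0) : (lf u v W).leadingCoeff = wedge v W :=
  Polynomial.leadingCoeff_linear h

theorem lf_roots {W : ℂ × ℂ} (h : wedge v W ≠ 0) :
    (lf u v W).roots = {-((wedge v W)⁻¹ * wedge u W)} := by
  unfold lf
  rw [Polynomial.roots_C_mul_X_add_C _ h]

theorem lf_point (huv : wedge u v = 1) {W : ℂ × ℂ} (h : wedge v W ≠ 0) :
    W = (-wedge v W) • (u + (-((wedge v W)⁻¹ * wedge u W)) • v) := by
  have e : W = (-wedge v W) • u + wedge u W • v := by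
    simp only [wedge] at huv ⊢
    ext
    · simp; linear_combination (-W.1) * huv
    · simp; linear_combination (-W.2) * huv
  rw [smul_add, smul_smul]
  have : -wedge v W * -((wedge v W)⁻¹ * wedge u W) = wedge u W := by field_simp
  rw [this]
  exact e

theorem RR_lf (huv : wedge u v = 1) {W W' : ℂ × ℂ} (h : wedge v W ≠ 0) (h' : wedge v W' ≠ 0) :
    RR (lf u v W) (lf u v W') = ‖wedge W W'‖ := by
  rw [RR_eval, lf_lc h, lf_deg h', lf_roots h]
  simp only [Multiset.map_singleton, Multiset.prod_singleton, pow_one, lf_eval]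
  conv_rhs => rw [lf_point huv h, wedge_smul_left, norm_mul, norm_neg]

/-- the chart is generic up to level `N` -/
def Gen (d : ℕ) (F₀ F₁ : MvPolynomial (Fin 2) ℂ) (u v : ℂ × ℂ) (N : ℕ) : Prop :=
  ∀ m, 1 ≤ m → m ≤ N → qP F₀ F₁ u v m ≠ 0 ∧ (qP F₀ F₁ u v m).natDegree = d ^ m + 1 ∧
    Gam d F₀ F₁ u v (qP F₀ F₁ u v m) = 1

theorem gen_of (hd : 2 ≤ d) (h₀ : F₀.IsHomogeneous d) (h₁ : F₁.IsHomogeneous d)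
    (hcz : ∀ Z : ℂ × ℂ, ev F₀ Z = 0 → ev F₁ Z = 0 → Z = 0)
    (hF : Good (Fmap F₀ F₁) d) (huv : wedge u v = 1) {N : ℕ}
    (hv : ∀ m, 1 ≤ m → m ≤ N → wedge ((Fmap F₀ F₁)^[m] v) v ≠ 0) : Gen d F₀ F₁ u v N := by
  intro m hm hmN
  obtain ⟨W, hW⟩ := Q_split h₀ h₁ m
  have hWv : ∀ i, wedge v (W i) ≠ 0 := by
    intro i h
    apply hv m hm hmN
    rw [hW]
    exact Finset.prod_eq_zero (Finset.mem_univ i) h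
  have hq : qP F₀ F₁ u v m = ∏ i, lf u v (W i) := by
    apply Polynomial.funext
    intro w
    rw [qP_eval, hW, Polynomial.eval_prod]
    exact Finset.prod_congr rfl fun i _ => (lf_eval _ _).symm
  have hne : ∀ i ∈ Finset.univ, lf u v (W i) ≠ 0 := fun i _ => lf_ne (hWv i)
  refine ⟨?_, ?_, ?_⟩
  · rw [hq, Finset.prod_ne_zero_iff]; exact hne
  · rw [hq, Polynomial.natDegree_prod _ _ hne, Finset.sum_congr rfl fun i _ => lf_deg (hWv i)]
    simp
  · rw [hq, Gam_prod _ _ hne, ← (gam_prod hd h₀ h₁ hcz hF hm Finset.univ W hW).2]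
    refine Finset.prod_congr rfl fun i _ => ?_
    unfold Gam
    rw [lf_lc (hWv i), lf_roots (hWv i)]
    simp only [Multiset.map_singleton, Multiset.prod_singleton]
    set r := -((wedge v (W i))⁻¹ * wedge u (W i)) with hr
    have hp := lf_point huv (hWv i)
    rw [← hr] at hp
    have h0 : wedge (u + r • v) (W i) = 0 := by
      rw [hp, wedge_smul_right, wedge_self, mul_zero]
    have := gam_smul hd h₀ h₁ hcz (line_ne huv r) hm
      (by rw [hW]; exact Finset.prod_eq_zero (Finset.mem_univ i) h0) (neg_ne_zero.mpr (hWv i))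
    rw [← hp, norm_neg] at this
    exact this.symm

theorem RR_euclid (hd : 2 ≤ d) (h₀ : F₀.IsHomogeneous d) (h₁ : F₁.IsHomogeneous d)
    (hcz : ∀ Z : ℂ × ℂ, ev F₀ Z = 0 → ev F₁ Z = 0 → Z = 0) (huv : wedge u v = 1) {N : ℕ}
    (hG : Gen d F₀ F₁ u v N) (s : ℕ) : ∀ a b : ℕ, a + b = s → 1 ≤ a → a ≤ N → 1 ≤ b → b ≤ N →
    ∀ ra rb, qP F₀ F₁ u v a = qP F₀ F₁ u v (Nat.gcd a b) * ra →
      qP F₀ F₁ u v b = qP F₀ F₁ u v (Nat.gcd a b) * rb → RR ra rb = 1 := by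
  induction s using Nat.strong_induction_on with
  | _ s ih =>
  intro a b hs ha haN hb hbN ra rb hra hrb
  wlog hab : b ≤ a generalizing a b ra rb
  · rw [RR_symm]
    exact this b a (by omega) hb hbN ha haN rb ra (by rw [Nat.gcd_comm]; exact hrb)
      (by rw [Nat.gcd_comm]; exact hra) (by omega)
  set g := Nat.gcd a b with hg
  have hg1 : 1 ≤ g := Nat.gcd_pos_of_pos_left _ ha
  have hgb : g ≤ b := Nat.gcd_le_right _ hb
  obtain ⟨qg0, qgd, qgG⟩ := hG g hg1 (hgb.trans hbN)
  obtain ⟨qb0, qbd, qbG⟩ := hG b hb hbN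
  obtain ⟨qa0, qad, qaG⟩ := hG a ha haN
  rcases hab.eq_or_lt with rfl | hlt
  · have hgb' : g = b := by simp [hg]
    rw [hgb'] at hra hrb qg0
    have h1 : ra = 1 := by
      have := mul_left_cancel₀ qg0 ((mul_one _).trans hra); exact this.symm
    have h2 : rb = 1 := by
      have := mul_left_cancel₀ qg0 ((mul_one _).trans hrb); exact this.symm
    rw [RR_eval, h1, h2]; simp
  obtain ⟨a', rfl⟩ : ∃ a', a = a' + b := ⟨a - b, by omega⟩
  have ha' : 1 ≤ a' := by omega
  obtain ⟨qap0, qapd, qapG⟩ := hG a' ha' (by omega)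
  have hgcd : Nat.gcd a' b = g := by rw [hg]; simp
  obtain ⟨c, hc⟩ : g ∣ a' := hgcd ▸ Nat.gcd_dvd_left a' b
  obtain ⟨ra', hra'⟩ := q_dvd (F₀ := F₀) (F₁ := F₁) h₀ h₁ huv g c
  rw [← hc] at hra'
  have hih := ih (a' + b) (by omega) a' b rfl ha' (by omega) hb hbN ra' rb
    (by rw [hgcd]; exact hra') (by rw [hgcd]; exact hrb)
  have hrb0 : rb ≠ 0 := by rintro rfl; exact qb0 (by rw [hrb, mul_zero])
  have hra0 : ra ≠ 0 := by rintro rfl; exact qa0 (by rw [hra, mul_zero])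
  have hrap0 : ra' ≠ 0 := by rintro rfl; exact qap0 (by rw [hra', mul_zero])
  have hcong : rb ∣ ra - PP F₀ F₁ u v b ^ (d ^ a') * ra' := by
    have := q_add (F₀ := F₀) (F₁ := F₁) h₀ h₁ huv a' b
    rw [hra, hrb, hra'] at this
    have e : qP F₀ F₁ u v g * ra - PP F₀ F₁ u v b ^ d ^ a' * (qP F₀ F₁ u v g * ra') =
      qP F₀ F₁ u v g * (ra - PP F₀ F₁ u v b ^ d ^ a' * ra') := by ring
    rw [e] at this
    exact (mul_dvd_mul_iff_left qg0).mp this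
  have hev : ∀ x ∈ rb.roots, ‖ra.eval x‖ =
      gam d F₀ F₁ (u + x • v) ^ (d ^ a' * (d ^ b - 1)) * ‖ra'.eval x‖ := by
    intro x hx
    have hx0 : rb.eval x = 0 := (Polynomial.mem_roots'.mp hx).2
    obtain ⟨y, hy⟩ := hcong
    have h1 := congrArg (Polynomial.eval x) hy
    simp only [Polynomial.eval_sub, Polynomial.eval_mul, Polynomial.eval_pow, hx0, zero_mul] at h1
    have h2 : (qP F₀ F₁ u v b).eval x = 0 := by rw [hrb]; simp [hx0]
    have h3 := gam_spec hd h₀ h₁ hcz (line_ne huv x) hb (root_eigen huv h2)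
    rw [sub_eq_zero.mp h1, norm_mul, norm_pow, h3, ← pow_mul, mul_comm (d ^ b - 1)]
  have hdega : d ^ g + 1 + ra.natDegree = d ^ (a' + b) + 1 := by
    rw [← qad, hra, Polynomial.natDegree_mul qg0 hra0, qgd]
  have hdega' : d ^ g + 1 + ra'.natDegree = d ^ a' + 1 := by
    rw [← qapd, hra', Polynomial.natDegree_mul qg0 hrap0, qgd]
  have hdeg : ra.natDegree = d ^ a' * (d ^ b - 1) + ra'.natDegree := by
    have h1 : d ^ (a' + b) = d ^ a' * (d ^ b - 1) + d ^ a' := by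
      have : 1 ≤ d ^ b := Nat.one_le_pow _ _ (by omega)
      obtain ⟨E, hE⟩ : ∃ E, d ^ b = E + 1 := ⟨d ^ b - 1, by omega⟩
      rw [pow_add, hE]; simp; ring
    omega
  have hGb : Gam d F₀ F₁ u v rb = 1 := by
    have := qbG
    rw [hrb, Gam_mul qg0 hrb0, qgG, one_mul] at this
    exact this
  rw [RR_symm, RR_eval, Multiset.map_congr rfl hev, Multiset.prod_map_mul, hdeg, pow_add]
  rw [Multiset.prod_map_pow]
  rw [RR_symm, RR_eval] at hih
  unfold Gam at hGb
  calc _ = (‖rb.leadingCoeff‖ * (rb.roots.map fun x => gam d F₀ F₁ (u + x • v)).prod) ^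
          (d ^ a' * (d ^ b - 1)) * (‖rb.leadingCoeff‖ ^ ra'.natDegree *
          (rb.roots.map fun x => ‖ra'.eval x‖).prod) := by rw [mul_pow]; ring
    _ = 1 := by rw [hGb, hih]; simp

theorem exists_chart (hd : 2 ≤ d) (h₀ : F₀.IsHomogeneous d) (h₁ : F₁.IsHomogeneous d)
    (hcz : ∀ Z : ℂ × ℂ, ev F₀ Z = 0 → ev F₁ Z = 0 → Z = 0)
    (hF : Good (Fmap F₀ F₁) d) (N : ℕ) : ∃ u v : ℂ × ℂ, wedge u v = 1 ∧
    ∀ m, 1 ≤ m → m ≤ N → wedge ((Fmap F₀ F₁)^[m] v) v ≠ 0 := by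
  choose W hW using fun m => Q_split (d := d) h₀ h₁ m
  have hfin : (⋃ m ∈ Finset.Icc 1 N, ⋃ i, {w : ℂ | wedge (1, w) (W m i) = 0}).Finite := by
    refine Set.Finite.biUnion (Finset.finite_toSet _) fun m hm => Set.finite_iUnion fun i => ?_
    have hm1 : 1 ≤ m := by
      have : m ∈ Finset.Icc 1 N := hm
      exact (Finset.mem_Icc.mp this).1
    have hne := (gam_prod hd h₀ h₁ hcz hF hm1 Finset.univ (W m) (hW m)).1 i (Finset.mem_univ _)
    refine (Set.finite_singleton ((W m i).2 / (W m i).1)).subset ?_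
    intro w hw
    have hw' : 1 * (W m i).2 - w * (W m i).1 = 0 := hw
    by_cases h1 : (W m i).1 = 0
    · exfalso
      apply hne
      rw [h1] at hw'
      ext
      · exact h1
      · simpa using hw'
    · rw [Set.mem_singleton_iff, eq_div_iff h1]
      linear_combination -hw'
  obtain ⟨w, hw⟩ := hfin.exists_notMem
  refine ⟨(0, -1), (1, w), by simp [wedge], fun m hm hmN h => hw ?_⟩
  rw [hW, Finset.prod_eq_zero_iff] at h
  obtain ⟨i, _, hi⟩ := h
  simp only [Set.mem_iUnion]
  exact ⟨m, Finset.mem_Icc.mpr ⟨hm, hmN⟩, i, hi⟩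

theorem incomparable (hd : 2 ≤ d) (h₀ : F₀.IsHomogeneous d) (h₁ : F₁.IsHomogeneous d)
    (hcz : ∀ Z : ℂ × ℂ, ev F₀ Z = 0 → ev F₁ Z = 0 → Z = 0)
    (hF : Good (Fmap F₀ F₁) d) {n : ℕ} (hn : 1 ≤ n) {Zp : ℕ → ℕ → ℂ × ℂ} {D : ℕ → ℕ}
    (hdyn : ∀ m ∈ n.divisors, ∀ Z : ℂ × ℂ,
      wedge ((Fmap F₀ F₁)^[m] Z) Z =
        ∏ k ∈ m.divisors, ∏ j ∈ Finset.range (D k), wedge Z (Zp k j)) (s : ℕ) :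
    ∀ k m : ℕ, k + m = s → k ∣ n → m ∣ n → ¬ k ∣ m → ¬ m ∣ k →
      ∏ i ∈ Finset.range (D k), ∏ j ∈ Finset.range (D m), ‖wedge (Zp k i) (Zp m j)‖ = 1 := by
  obtain ⟨u, v, huv, hv⟩ := exists_chart hd h₀ h₁ hcz hF n
  have hG := gen_of hd h₀ h₁ hcz hF huv hv
  have hvn := hv n hn le_rfl
  rw [hdyn n (by simp; omega)] at hvn
  have hWv : ∀ k ∈ n.divisors, ∀ j ∈ Finset.range (D k), wedge v (Zp k j) ≠ 0 := by
    intro k hk j hj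
    exact Finset.prod_ne_zero_iff.mp (Finset.prod_ne_zero_iff.mp hvn k hk) j hj
  set φ : ℕ → Polynomial ℂ := fun k => ∏ j ∈ Finset.range (D k), lf u v (Zp k j) with hφ
  have hφ0 : ∀ k ∈ n.divisors, φ k ≠ 0 := by
    intro k hk
    rw [hφ]
    exact Finset.prod_ne_zero_iff.mpr fun j hj => lf_ne (hWv k hk j hj)
  have hq : ∀ a ∈ n.divisors, qP F₀ F₁ u v a = ∏ k ∈ a.divisors, φ k := by
    intro a ha
    apply Polynomial.funext
    intro w
    rw [qP_eval, hdyn a ha, Polynomial.eval_prod]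
    refine Finset.prod_congr rfl fun k _ => ?_
    rw [hφ, Polynomial.eval_prod]
    exact Finset.prod_congr rfl fun i _ => (lf_eval _ _).symm
  have hRφ : ∀ k ∈ n.divisors, ∀ m ∈ n.divisors, RR (φ k) (φ m) =
      ∏ i ∈ Finset.range (D k), ∏ j ∈ Finset.range (D m), ‖wedge (Zp k i) (Zp m j)‖ := by
    intro k hk m hm
    rw [hφ, RR_prod_left _ _ _ fun j hj => lf_ne (hWv k hk j hj)]
    refine Finset.prod_congr rfl fun i hi => ?_
    rw [RR_prod_right _ _ _ fun j hj => lf_ne (hWv m hm j hj)]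
    refine Finset.prod_congr rfl fun j hj => ?_
    exact RR_lf huv (hWv k hk i hi) (hWv m hm j hj)
  induction s using Nat.strong_induction_on with
  | _ s ih =>
  intro k m hs hk hm hkm hmk
  have hk1 : k ∈ n.divisors := by simp [hk]; omega
  have hm1 : m ∈ n.divisors := by simp [hm]; omega
  have hkpos : 1 ≤ k := Nat.pos_of_mem_divisors hk1
  have hmpos : 1 ≤ m := Nat.pos_of_mem_divisors hm1
  rw [← hRφ k hk1 m hm1]
  set g := Nat.gcd k m with hg
  have hgk : g ∣ k := Nat.gcd_dvd_left k m
  have hgm : g ∣ m := Nat.gcd_dvd_right k m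
  have hg1 : g ∈ n.divisors := by simp [hgk.trans hk]; omega
  have hsplit : ∀ a, a ∈ n.divisors → g ∣ a → qP F₀ F₁ u v a =
      qP F₀ F₁ u v g * ∏ k ∈ a.divisors \ g.divisors, φ k := by
    intro a ha hga
    rw [hq a ha, hq g hg1, mul_comm, Finset.prod_sdiff]
    exact Nat.divisors_subset_of_dvd (by have := Nat.pos_of_mem_divisors ha; omega) hga
  have hR := RR_euclid hd h₀ h₁ hcz huv hG (k + m) k m rfl hkpos (Nat.divisor_le hk1) hmpos
    (Nat.divisor_le hm1) _ _ (hsplit k hk1 hgk) (hsplit m hm1 hgm)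
  have hsubn : ∀ a, a ∈ n.divisors → ∀ b ∈ a.divisors \ g.divisors, b ∈ n.divisors := by
    intro a ha b hb
    simp only [Finset.mem_sdiff, Nat.mem_divisors] at hb ha ⊢
    exact ⟨hb.1.1.trans ha.1, ha.2⟩
  rw [RR_prod_left _ _ _ fun b hb => hφ0 b (hsubn k hk1 b hb)] at hR
  have hR2 : ∀ k' ∈ k.divisors \ g.divisors, RR (φ k') (∏ m' ∈ m.divisors \ g.divisors, φ m') =
      ∏ m' ∈ m.divisors \ g.divisors, RR (φ k') (φ m') := fun k' _ =>
    RR_prod_right _ _ _ fun b hb => hφ0 b (hsubn m hm1 b hb)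
  rw [Finset.prod_congr rfl hR2] at hR
  have hkmem : k ∈ k.divisors \ g.divisors := by
    simp only [Finset.mem_sdiff, Nat.mem_divisors, dvd_refl, true_and, not_and]
    exact ⟨by omega, fun h => absurd (h.trans hgm) hkm⟩
  have hmmem : m ∈ m.divisors \ g.divisors := by
    simp only [Finset.mem_sdiff, Nat.mem_divisors, dvd_refl, true_and, not_and]
    exact ⟨by omega, fun h => absurd (h.trans hgk) hmk⟩
  have hoff : ∀ k' ∈ k.divisors \ g.divisors, ∀ m' ∈ m.divisors \ g.divisors, k' + m' < s →
      RR (φ k') (φ m') = 1 := by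
    intro k' hk' m' hm' hlt
    have hkpn := hsubn k hk1 k' hk'
    have hmpn := hsubn m hm1 m' hm'
    rw [hRφ k' hkpn m' hmpn]
    simp only [Finset.mem_sdiff, Nat.mem_divisors] at hk' hm'
    refine ih _ hlt k' m' rfl (Nat.dvd_of_mem_divisors hkpn) (Nat.dvd_of_mem_divisors hmpn) ?_ ?_
    · intro h
      exact hk'.2 ⟨Nat.dvd_gcd hk'.1.1 (h.trans hm'.1.1), Nat.pos_iff_ne_zero.mp (Nat.pos_of_mem_divisors hg1)⟩
    · intro h
      exact hm'.2 ⟨Nat.dvd_gcd (h.trans hk'.1.1) hm'.1.1, Nat.pos_iff_ne_zero.mp (Nat.pos_of_mem_divisors hg1)⟩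
  have hle : ∀ a b, 1 ≤ a → b ∈ a.divisors \ g.divisors → b ≤ a := by
    intro a b ha hb
    exact Nat.divisor_le (Finset.mem_sdiff.mp hb).1
  rw [Finset.prod_eq_single_of_mem k hkmem, Finset.prod_eq_single_of_mem m hmmem] at hR
  · exact hR
  · intro m' hm' hne
    have := hle m m' hmpos hm'
    exact hoff k hkmem m' hm' (by omega)
  · intro k' hk' hne
    have := hle k k' hkpos hk'
    refine Finset.prod_eq_one fun m' hm' => hoff k' hk' m' hm' ?_
    have := hle m m' hmpos hm'
    omega

end Incomparable

section LocalPart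

variable {d : ℕ} {F₀ F₁ : MvPolynomial (Fin 2) ℂ}

theorem gam_prod_dyn (hd : 2 ≤ d) (h₀ : F₀.IsHomogeneous d) (h₁ : F₁.IsHomogeneous d)
    (hcz : ∀ Z : ℂ × ℂ, ev F₀ Z = 0 → ev F₁ Z = 0 → Z = 0)
    (hF : Good (Fmap F₀ F₁) d) {n : ℕ} {Zp : ℕ → ℕ → ℂ × ℂ} {D : ℕ → ℕ}
    (hdyn : ∀ m ∈ n.divisors, ∀ Z : ℂ × ℂ,
      wedge ((Fmap F₀ F₁)^[m] Z) Z =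
        ∏ k ∈ m.divisors, ∏ j ∈ Finset.range (D k), wedge Z (Zp k j)) (k : ℕ) :
    k ∈ n.divisors → ∏ j ∈ Finset.range (D k), gam d F₀ F₁ (Zp k j) = 1 := by
  induction k using Nat.strong_induction_on with
  | _ k ih =>
  intro hk
  have hkpos : 1 ≤ k := Nat.pos_of_mem_divisors hk
  have h := (gam_prod hd h₀ h₁ hcz hF hkpos
    (k.divisors.sigma fun k => Finset.range (D k)) (fun x => Zp x.1 x.2) (by
      intro Z
      rw [hdyn k hk, Finset.prod_sigma])).2
  rw [Finset.prod_sigma, Finset.prod_eq_single_of_mem k (by simp; omega)] at h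
  · exact h
  · intro k' hk' hne
    refine ih k' ?_ ?_
    · exact lt_of_le_of_ne (Nat.divisor_le hk') hne
    · simp only [Nat.mem_divisors] at hk hk' ⊢
      exact ⟨hk'.1.trans hk.1, hk.2⟩

theorem lam_eq_Lam (h₀ : F₀.IsHomogeneous d) (h₁ : F₁.IsHomogeneous d)
    (hcz : ∀ Z : ℂ × ℂ, ev F₀ Z = 0 → ev F₁ Z = 0 → Z = 0) {m : ℕ} {Z : ℂ × ℂ} (hx : Z.1 ≠ 0)
    (hQ : wedge ((Fmap F₀ F₁)^[m] Z) Z = 0) :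
    deriv (fun w : ℂ => ((Fmap F₀ F₁)^[m] (1, w)).2 / ((Fmap F₀ F₁)^[m] (1, w)).1) (Z.2 / Z.1)
      = Lam F₀ F₁ Z (0, 1 / Z.1) m 0 := by
  set v : ℂ × ℂ := (0, 1 / Z.1) with hv
  have huv : wedge Z v = 1 := by simp [wedge, hv, hx]
  have hq : (qP F₀ F₁ Z v m).eval 0 = 0 := by rw [qP_eval]; simpa using hQ
  have hP := root_PP_ne hcz huv hq
  have hE := root_eigen huv hq
  rw [← pP_eval] at hE
  simp only [zero_smul, add_zero] at hE
  set p1 := (pP F₀ F₁ Z v m).1 with hp1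
  set p2 := (pP F₀ F₁ Z v m).2 with hp2
  set P := (PP F₀ F₁ Z v m).eval 0 with hPd
  obtain ⟨E1, E2⟩ := Prod.ext_iff.mp hE
  simp only [Prod.smul_fst, Prod.smul_snd, smul_eq_mul] at E1 E2
  have hf : (fun w : ℂ => ((Fmap F₀ F₁)^[m] (1, w)).2 / ((Fmap F₀ F₁)^[m] (1, w)).1) =
      fun w => p2.eval (Z.1 ^ 2 * (w - Z.2 / Z.1)) / p1.eval (Z.1 ^ 2 * (w - Z.2 / Z.1)) := by
    funext w
    have h1 := pP_eval (F₀ := F₀) (F₁ := F₁) (u := Z) (v := v) m (Z.1 ^ 2 * (w - Z.2 / Z.1))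
    have h2 : Z + (Z.1 ^ 2 * (w - Z.2 / Z.1)) • v = Z.1 • ((1, w) : ℂ × ℂ) := by
      ext
      · simp [hv]
      · simp [hv]; field_simp; ring
    rw [h2, Fmap_iter_smul h₀ h₁] at h1
    obtain ⟨H1, H2⟩ := Prod.ext_iff.mp h1
    simp only [Prod.smul_fst, Prod.smul_snd, smul_eq_mul] at H1 H2
    rw [H1, H2, mul_div_mul_left _ _ (pow_ne_zero _ hx)]
  rw [hf]
  have hin : HasDerivAt (fun w : ℂ => Z.1 ^ 2 * (w - Z.2 / Z.1)) (Z.1 ^ 2) (Z.2 / Z.1) := by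
    simpa using ((hasDerivAt_id (Z.2 / Z.1)).sub_const (Z.2 / Z.1)).const_mul (Z.1 ^ 2)
  have h0 : Z.1 ^ 2 * (Z.2 / Z.1 - Z.2 / Z.1) = 0 := by ring
  have hd1 : HasDerivAt (fun w : ℂ => p1.eval (Z.1 ^ 2 * (w - Z.2 / Z.1)))
      ((Polynomial.derivative p1).eval 0 * Z.1 ^ 2) (Z.2 / Z.1) := by
    have := HasDerivAt.comp (Z.2 / Z.1) (p1.hasDerivAt (Z.1 ^ 2 * (Z.2 / Z.1 - Z.2 / Z.1))) hin
    rw [h0] at this; exact this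
  have hd2 : HasDerivAt (fun w : ℂ => p2.eval (Z.1 ^ 2 * (w - Z.2 / Z.1)))
      ((Polynomial.derivative p2).eval 0 * Z.1 ^ 2) (Z.2 / Z.1) := by
    have := HasDerivAt.comp (Z.2 / Z.1) (p2.hasDerivAt (Z.1 ^ 2 * (Z.2 / Z.1 - Z.2 / Z.1))) hin
    rw [h0] at this; exact this
  have hdv := hd2.div hd1 (by rw [h0, E1]; exact mul_ne_zero hP hx)
  have hdv' := hdv.deriv
  rw [h0, E1, E2] at hdv'
  refine Eq.trans ?_ (hdv'.trans ?_)
  · rfl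
  unfold Lam
  have hq' : (Polynomial.derivative (qP F₀ F₁ Z v m)).eval 0 =
      (Polynomial.derivative p1).eval 0 * Z.2 + P - (Polynomial.derivative p2).eval 0 * Z.1 := by
    have : qP F₀ F₁ Z v m = p1 * (eP Z v).2 - p2 * (eP Z v).1 := rfl
    rw [this]
    simp only [Polynomial.derivative_sub, Polynomial.derivative_mul, Polynomial.eval_sub,
      Polynomial.eval_add, Polynomial.eval_mul, E1, E2]
    simp [eP, hv]
    field_simp
  rw [hq', ← hPd]
  field_simp
  ring

theorem geom_cyclotomic {r s : ℕ} (hr : 1 ≤ r) (hsr : s ∣ r) (x : ℂ) :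
    ∑ i ∈ Finset.range (r / s), (x ^ s) ^ i =
      ∏ t ∈ r.divisors \ s.divisors, (Polynomial.cyclotomic t ℂ).eval x := by
  obtain ⟨k, rfl⟩ := hsr
  have hs : 0 < s := Nat.pos_of_ne_zero (by rintro rfl; simp at hr)
  have hk : 0 < k := Nat.pos_of_ne_zero (by rintro rfl; simp at hr)
  rw [Nat.mul_div_cancel_left _ hs, ← Polynomial.eval_prod]
  have h1 : (Polynomial.X ^ s - 1 : Polynomial ℂ) ≠ 0 :=
    (Polynomial.monic_X_pow_sub_C (1 : ℂ) hs.ne').ne_zero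
  have h2 : (Polynomial.X ^ s - 1 : Polynomial ℂ) * ∏ t ∈ (s * k).divisors \ s.divisors,
      Polynomial.cyclotomic t ℂ = (Polynomial.X ^ s - 1) *
        ∑ i ∈ Finset.range k, (Polynomial.X ^ s) ^ i := by
    rw [mul_geom_sum, ← pow_mul]
    exact Polynomial.X_pow_sub_one_mul_prod_cyclotomic_eq_X_pow_sub_one_of_dvd ℂ
      (Dvd.intro _ rfl) (by positivity)
  rw [mul_left_cancel₀ h1 h2, Polynomial.eval_finsetSum]
  simp

theorem local_lemma (hd : 2 ≤ d) (h₀ : F₀.IsHomogeneous d) (h₁ : F₁.IsHomogeneous d)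
    (hcz : ∀ Z : ℂ × ℂ, ev F₀ Z = 0 → ev F₁ Z = 0 → Z = 0)
    {n : ℕ} {Zp : ℕ → ℕ → ℂ × ℂ} {D : ℕ → ℕ}
    (hfst : ∀ m ∈ n.divisors, ∀ j ∈ Finset.range (D m), (Zp m j).1 ≠ 0)
    (hdyn : ∀ m ∈ n.divisors, ∀ Z : ℂ × ℂ,
      wedge ((Fmap F₀ F₁)^[m] Z) Z =
        ∏ k ∈ m.divisors, ∏ j ∈ Finset.range (D k), wedge Z (Zp k j))
    {l r s j : ℕ} (hlr : l * r ∈ n.divisors) (hsr : s ∣ r) (hj : j ∈ Finset.range (D l)) :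
    (∏ k ∈ (l * r).divisors \ (l * s).divisors, ‖∏ i ∈ Finset.range (D k),
        wedge (Zp l j) (Zp k i)‖) * gam d F₀ F₁ (Zp l j) ^ (d ^ (l * s) - 1) =
      gam d F₀ F₁ (Zp l j) ^ (d ^ (l * r) - 1) *
      ∏ t ∈ r.divisors \ s.divisors, ‖(Polynomial.cyclotomic t ℂ).eval (lam F₀ F₁ Zp l j)‖ := by
  have hn0 : n ≠ 0 := (Nat.mem_divisors.mp hlr).2
  have hdvd : ∀ {a}, a ∣ l * r → a ∈ n.divisors := fun h =>
    Nat.mem_divisors.mpr ⟨h.trans (Nat.mem_divisors.mp hlr).1, hn0⟩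
  have hl : l ∈ n.divisors := hdvd (Dvd.intro _ rfl)
  have hls : l * s ∈ n.divisors := hdvd (mul_dvd_mul_left l hsr)
  have hlpos := Nat.pos_of_mem_divisors hl
  have hlspos := Nat.pos_of_mem_divisors hls
  have hlrpos := Nat.pos_of_mem_divisors hlr
  have hspos : 0 < s := Nat.pos_of_mul_pos_left hlspos
  have hrpos : 0 < r := Nat.pos_of_mul_pos_left hlrpos
  set Z := Zp l j with hZ
  have hx : Z.1 ≠ 0 := hfst l hl j hj
  set v : ℂ × ℂ := (0, 1 / Z.1) with hv
  have huv : wedge Z v = 1 := by simp [wedge, hv, hx]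
  have hWv : ∀ k ∈ n.divisors, ∀ i ∈ Finset.range (D k), wedge v (Zp k i) ≠ 0 := by
    intro k hk i hi
    have := hfst k hk i hi
    simp [wedge, hv, this, hx]
  set φ : ℕ → Polynomial ℂ := fun k => ∏ j ∈ Finset.range (D k), lf Z v (Zp k j) with hφ
  have hφ0 : ∀ k ∈ n.divisors, φ k ≠ 0 := by
    intro k hk
    rw [hφ]
    exact Finset.prod_ne_zero_iff.mpr fun j hj => lf_ne (hWv k hk j hj)
  have hq : ∀ a ∈ n.divisors, qP F₀ F₁ Z v a = ∏ k ∈ a.divisors, φ k := by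
    intro a ha
    apply Polynomial.funext
    intro w
    rw [qP_eval, hdyn a ha, Polynomial.eval_prod]
    refine Finset.prod_congr rfl fun k _ => ?_
    rw [hφ, Polynomial.eval_prod]
    exact Finset.prod_congr rfl fun i _ => (lf_eval _ _).symm
  have hq0 : ∀ a ∈ n.divisors, qP F₀ F₁ Z v a ≠ 0 := by
    intro a ha
    rw [hq a ha, Finset.prod_ne_zero_iff]
    intro k hk
    simp only [Nat.mem_divisors] at ha hk
    exact hφ0 k (Nat.mem_divisors.mpr ⟨hk.1.trans ha.1, ha.2⟩)
  have hQ : ∀ a ∈ n.divisors, l ∣ a → wedge ((Fmap F₀ F₁)^[a] Z) Z = 0 := by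
    intro a ha hla
    rw [hdyn a ha]
    refine Finset.prod_eq_zero (i := l) (Nat.mem_divisors.mpr
      ⟨hla, (Nat.pos_of_mem_divisors ha).ne'⟩) (Finset.prod_eq_zero hj ?_)
    exact wedge_self _
  have hw : ∀ a ∈ n.divisors, l ∣ a → (qP F₀ F₁ Z v a).eval 0 = 0 := by
    intro a ha hla
    rw [qP_eval]; simpa using hQ a ha hla
  have hg : ∀ a ∈ n.divisors, l ∣ a → ‖(PP F₀ F₁ Z v a).eval 0‖ =
      gam d F₀ F₁ Z ^ (d ^ a - 1) := by
    intro a ha hla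
    have h1 := root_eigen huv (hw a ha hla)
    simp only [zero_smul, add_zero] at h1
    exact gam_spec hd h₀ h₁ hcz (by intro h; exact hx (by rw [h]; rfl))
      (Nat.pos_of_mem_divisors ha) h1
  have hlam : lam F₀ F₁ Zp l j = Lam F₀ F₁ Z v l 0 :=
    lam_eq_Lam h₀ h₁ hcz hx (hQ l hl dvd_rfl)
  have hLam : Lam F₀ F₁ Z v (l * s) 0 = lam F₀ F₁ Zp l j ^ s := by
    rw [hlam]
    exact Lam_pow h₀ h₁ hcz huv (hq0 l hl) (hw l hl dvd_rfl) hspos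
  have hrs : 1 ≤ r / s := Nat.div_pos (Nat.le_of_dvd hrpos hsr) hspos
  obtain ⟨T, hT, hTe⟩ := T_exists h₀ h₁ hcz huv (hq0 _ hls) (hw _ hls (Dvd.intro _ rfl)) hrs
  have e : l * s * (r / s) = l * r := by rw [mul_assoc, Nat.mul_div_cancel' hsr]
  rw [e] at hT hTe
  have hT' : T = ∏ k ∈ (l * r).divisors \ (l * s).divisors, φ k := by
    apply mul_left_cancel₀ (hq0 _ hls)
    rw [← hT, hq _ hlr, hq _ hls, mul_comm (∏ k ∈ (l * s).divisors, φ k), Finset.prod_sdiff]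
    exact Nat.divisors_subset_of_dvd (by positivity) (mul_dvd_mul_left l hsr)
  have hTev : T.eval 0 = ∏ k ∈ (l * r).divisors \ (l * s).divisors, ∏ i ∈ Finset.range (D k),
        wedge Z (Zp k i) := by
    rw [hT', Polynomial.eval_prod]
    refine Finset.prod_congr rfl fun k _ => ?_
    rw [hφ, Polynomial.eval_prod]
    refine Finset.prod_congr rfl fun i _ => ?_
    rw [lf_eval]; simp
  rw [hLam, geom_cyclotomic hrpos hsr, hTev] at hTe
  have hN := congrArg norm hTe
  rw [norm_mul, norm_mul, hg _ hls (Dvd.intro _ rfl), hg _ hlr (Dvd.intro _ rfl), norm_prod,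
    norm_prod] at hN
  exact hN

end LocalPart

section Final

theorem core_ind {R : ℕ} (hR : 1 ≤ R) (f : ℕ → ℝ) (x : ℂ)
    (hE : ∀ r, r ∣ R → ∀ s, s ∣ r → ∏ t ∈ r.divisors \ s.divisors, f t =
      ∏ t ∈ r.divisors \ s.divisors, ‖(Polynomial.cyclotomic t ℂ).eval x‖) (t : ℕ) :
    t ∣ R → 1 < t → f t = ‖(Polynomial.cyclotomic t ℂ).eval x‖ := by
  induction t using Nat.strong_induction_on with
  | _ t ih =>
  intro htR ht
  have hroot : ∀ a, 1 ≤ a → (Polynomial.cyclotomic a ℂ).eval x = 0 → IsPrimitiveRoot x a := by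
    intro a ha h
    haveI : NeZero (a : ℂ) := ⟨by exact_mod_cast (by omega : a ≠ 0)⟩
    exact Polynomial.isRoot_cyclotomic_iff.mp h
  obtain ⟨s, hst, hslt, hs⟩ : ∃ s, s ∣ t ∧ s < t ∧ ∀ t' ∈ t.divisors \ s.divisors, t' ≠ t →
      (Polynomial.cyclotomic t' ℂ).eval x ≠ 0 := by
    by_cases h : ∃ s, s ∣ t ∧ s < t ∧ (Polynomial.cyclotomic s ℂ).eval x = 0
    · obtain ⟨s, h1, h2, h3⟩ := h
      have hspos := Nat.pos_of_dvd_of_pos h1 (by omega)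
      refine ⟨s, h1, h2, fun t' ht' _ h0 => ?_⟩
      simp only [Finset.mem_sdiff, Nat.mem_divisors] at ht'
      have h4 := (hroot s hspos h3).unique
        (hroot t' (Nat.pos_of_dvd_of_pos ht'.1.1 (by omega)) h0)
      exact ht'.2 ⟨h4 ▸ dvd_rfl, by omega⟩
    · push Not at h
      refine ⟨1, one_dvd _, ht, fun t' ht' hne => ?_⟩
      simp only [Finset.mem_sdiff, Nat.mem_divisors] at ht'
      exact h t' ht'.1.1 (lt_of_le_of_ne (Nat.le_of_dvd (by omega) ht'.1.1) hne)
  have hspos := Nat.pos_of_dvd_of_pos hst (by omega)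
  have htm : t ∈ t.divisors \ s.divisors := by
    simp only [Finset.mem_sdiff, Nat.mem_divisors, dvd_refl, true_and, not_and]
    exact ⟨by omega, fun h => absurd (Nat.le_of_dvd hspos h) (by omega)⟩
  have h := hE t htR s hst
  rw [← Finset.mul_prod_erase _ _ htm, ← Finset.mul_prod_erase _ _ htm] at h
  have hc : ∏ a ∈ (t.divisors \ s.divisors).erase t, f a =
      ∏ a ∈ (t.divisors \ s.divisors).erase t, ‖(Polynomial.cyclotomic a ℂ).eval x‖ := by
    refine Finset.prod_congr rfl fun a ha => ?_
    simp only [Finset.mem_erase, Finset.mem_sdiff, Nat.mem_divisors] at ha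
    refine ih a (lt_of_le_of_ne (Nat.le_of_dvd (by omega) ha.2.1.1) ha.1)
      (ha.2.1.1.trans htR) ?_
    have h0 := Nat.pos_of_dvd_of_pos ha.2.1.1 (by omega)
    by_contra hle
    have : a = 1 := by omega
    subst this
    exact ha.2.2 ⟨one_dvd _, by omega⟩
  rw [hc] at h
  refine mul_right_cancel₀ ?_ h
  rw [Finset.prod_ne_zero_iff]
  intro a ha
  rw [Finset.mem_erase] at ha
  exact norm_ne_zero_iff.mpr (hs a ha.2 ha.1)

/-- the divisors of `l * r` not comparable with `l` -/
def JJ (l r : ℕ) : Finset ℕ := (l * r).divisors.filter fun k => ¬ l ∣ k ∧ ¬ k ∣ l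

theorem prod_split_JJ {l r s : ℕ} (hl : 1 ≤ l) (hr : 1 ≤ r) (hs : s ∣ r) (a : ℕ → ℝ) :
    (∏ k ∈ (l * r).divisors \ (l * s).divisors, a k) * ∏ k ∈ JJ l s, a k =
      (∏ t ∈ r.divisors \ s.divisors, a (l * t)) * ∏ k ∈ JJ l r, a k := by
  have hspos : 0 < s := Nat.pos_of_dvd_of_pos hs hr
  have hlpos : 0 < l := hl
  have hsub : JJ l s ⊆ JJ l r := by
    unfold JJ
    exact Finset.filter_subset_filter _
      (Nat.divisors_subset_of_dvd (by positivity) (mul_dvd_mul_left l hs))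
  rw [← Finset.prod_filter_mul_prod_filter_not ((l * r).divisors \ (l * s).divisors) (fun k => l ∣ k),
    ← Finset.prod_sdiff hsub, mul_assoc]
  congr 1
  · have : ((l * r).divisors \ (l * s).divisors).filter (fun k => l ∣ k) =
        (r.divisors \ s.divisors).image (fun t => l * t) := by
      ext k
      simp only [Finset.mem_filter, Finset.mem_sdiff, Nat.mem_divisors, Finset.mem_image]
      constructor
      · rintro ⟨⟨⟨h1, h2⟩, h3⟩, t, rfl⟩
        refine ⟨t, ⟨⟨Nat.dvd_of_mul_dvd_mul_left hlpos h1, by omega⟩, fun h => h3 ?_⟩, rfl⟩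
        exact ⟨mul_dvd_mul_left l h.1, by positivity⟩
      · rintro ⟨t, ⟨⟨h1, h2⟩, h3⟩, rfl⟩
        refine ⟨⟨⟨mul_dvd_mul_left l h1, by positivity⟩, fun h => h3 ?_⟩, Dvd.intro _ rfl⟩
        exact ⟨Nat.dvd_of_mul_dvd_mul_left hlpos h.1, by omega⟩
    rw [this, Finset.prod_image]
    intro x _ y _ hxy
    exact Nat.eq_of_mul_eq_mul_left hlpos hxy
  · congr 1
    refine Finset.prod_congr ?_ fun _ _ => rfl
    ext k
    simp only [JJ, Finset.mem_filter, Finset.mem_sdiff, Nat.mem_divisors]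
    constructor
    · rintro ⟨⟨h1, h2⟩, h3⟩
      refine ⟨⟨h1, h3, fun h => h2 ⟨h.mul_right s, by positivity⟩⟩, fun h => h2 h.1⟩
    · rintro ⟨⟨h1, h2, h3⟩, h4⟩
      exact ⟨⟨h1, fun h => h4 ⟨h, h2, h3⟩⟩, h2⟩

theorem moebius_h (M : ℕ) (K : ℕ → ℕ → ℝ) (hK : ∀ r, 1 ≤ r → ∀ j, K r j ≠ 0)
    (hK1 : ∀ r, 1 ≤ r → ∏ j ∈ Finset.range M, K r j = 1) :
    ∃ h : ℕ → ℕ → ℝ, (∀ r, 1 ≤ r → ∀ j, ∏ t ∈ r.divisors, h t j = K r j) ∧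
      ∀ t, 1 ≤ t → ∏ j ∈ Finset.range M, h t j = 1 := by
  let h : ℕ → ℕ → ℝ := fun t j =>
    ∏ x ∈ t.divisorsAntidiagonal, K x.2 j ^ (ArithmeticFunction.moebius x.1 : ℤ)
  have hpos : ∀ (t : ℕ), ∀ x ∈ t.divisorsAntidiagonal, 1 ≤ x.2 := by
    intro t x hx
    rw [Nat.mem_divisorsAntidiagonal] at hx
    refine Nat.pos_of_ne_zero fun h0 => hx.2 ?_
    rw [← hx.1, h0, mul_zero]
  refine ⟨h, ?_, ?_⟩
  · intro r hr j
    have := (ArithmeticFunction.prod_eq_iff_prod_pow_moebius_eq_of_nonzero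
      (f := fun t => h t j) (g := fun t => K t j) (fun t _ => ?_) (fun t ht => hK t ht j)).mpr
      (fun t _ => rfl)
    · exact this r hr
    · exact Finset.prod_ne_zero_iff.mpr fun x hx => zpow_ne_zero _ (hK _ (hpos t x hx) j)
  · intro t _
    change ∏ j ∈ Finset.range M, ∏ x ∈ t.divisorsAntidiagonal, _ = _
    rw [Finset.prod_comm]
    refine Finset.prod_eq_one fun x hx => ?_
    rw [Finset.prod_zpow, hK1 _ (hpos t x hx), one_zpow]

theorem final_aux {d : ℕ} {F₀ F₁ : MvPolynomial (Fin 2) ℂ}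
    (hd : 2 ≤ d) (h₀ : F₀.IsHomogeneous d) (h₁ : F₁.IsHomogeneous d)
    (hcz : ∀ Z : ℂ × ℂ, ev F₀ Z = 0 → ev F₁ Z = 0 → Z = 0)
    (hF : Good (Fmap F₀ F₁) d)
    {n : ℕ} (hn : 1 ≤ n) {Zp : ℕ → ℕ → ℂ × ℂ} {D : ℕ → ℕ}
    (hfst : ∀ m ∈ n.divisors, ∀ j ∈ Finset.range (D m), (Zp m j).1 ≠ 0)
    (hdyn : ∀ m ∈ n.divisors, ∀ Z : ℂ × ℂ,
      wedge ((Fmap F₀ F₁)^[m] Z) Z =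
        ∏ k ∈ m.divisors, ∏ j ∈ Finset.range (D k), wedge Z (Zp k j))
    {l R : ℕ} (hR : 1 < R) (hlR : l * R = n) :
    ∏ j ∈ Finset.range (D l), ‖∏ i ∈ Finset.range (D n), wedge (Zp l j) (Zp n i)‖ =
      ∏ j ∈ Finset.range (D l), ‖(Polynomial.cyclotomic R ℂ).eval (lam F₀ F₁ Zp l j)‖ := by
  classical
  have hl : 1 ≤ l := Nat.pos_of_ne_zero (by rintro rfl; omega)
  have hdv : ∀ r, r ∣ R → l * r ∈ n.divisors := fun r hr =>
    Nat.mem_divisors.mpr ⟨hlR ▸ mul_dvd_mul_left l hr, by omega⟩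
  set a : ℕ → ℕ → ℝ := fun k j => ‖∏ i ∈ Finset.range (D k), wedge (Zp l j) (Zp k i)‖ with ha
  have hIk : ∀ r, r ∣ R → ∀ k ∈ JJ l r, ∏ j ∈ Finset.range (D l), a k j = 1 := by
    intro r hr k hk
    simp only [JJ, Finset.mem_filter, Nat.mem_divisors] at hk
    have := incomparable hd h₀ h₁ hcz hF hn hdyn (l + k) l k rfl (Dvd.intro _ hlR)
      (hk.1.1.trans (Nat.dvd_of_mem_divisors (hdv r hr))) hk.2.1 hk.2.2
    rw [← this]
    exact Finset.prod_congr rfl fun j _ => norm_prod _ _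
  have ha0 : ∀ r, r ∣ R → ∀ k ∈ JJ l r, ∀ j ∈ Finset.range (D l), a k j ≠ 0 := by
    intro r hr k hk
    have h := hIk r hr k hk
    exact Finset.prod_ne_zero_iff.mp (by rw [h]; exact one_ne_zero)
  set γ : ℕ → ℝ := fun j => gam d F₀ F₁ (Zp l j) with hγ
  have hγ0 : ∀ j, γ j ≠ 0 := fun j => (gam_pos _).ne'
  have hl' : l ∈ n.divisors := by simpa using hdv 1 (one_dvd _)
  have hγ1 : ∏ j ∈ Finset.range (D l), γ j = 1 := gam_prod_dyn hd h₀ h₁ hcz hF hdyn l hl'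
  set K : ℕ → ℕ → ℝ := fun r j => if r ∣ R ∧ j ∈ Finset.range (D l) then
    (∏ k ∈ JJ l r, a k j) / γ j ^ (d ^ (l * r) - 1) else 1 with hK
  have hKr : ∀ r, r ∣ R → ∀ j ∈ Finset.range (D l), K r j =
      (∏ k ∈ JJ l r, a k j) / γ j ^ (d ^ (l * r) - 1) := by
    intro r hr j hj
    simp only [hK]
    rw [if_pos ⟨hr, hj⟩]
  have hK0 : ∀ r, 1 ≤ r → ∀ j, K r j ≠ 0 := by
    intro r _ j
    simp only [hK]
    split_ifs with h
    · exact div_ne_zero (Finset.prod_ne_zero_iff.mpr fun k hk => ha0 r h.1 k hk j h.2)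
        (pow_ne_zero _ (hγ0 j))
    · exact one_ne_zero
  have hK1 : ∀ r, 1 ≤ r → ∏ j ∈ Finset.range (D l), K r j = 1 := by
    intro r _
    by_cases hr : r ∣ R
    · rw [Finset.prod_congr rfl (hKr r hr), Finset.prod_div_distrib, Finset.prod_pow, hγ1,
        Finset.prod_comm, Finset.prod_congr rfl (hIk r hr)]
      simp
    · refine Finset.prod_eq_one fun j _ => ?_
      simp only [hK]
      rw [if_neg (fun h => hr h.1)]
  obtain ⟨h, hh, hh1⟩ := moebius_h (D l) K hK0 hK1
  have key : ∀ j ∈ Finset.range (D l), a n j * h R j =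
      ‖(Polynomial.cyclotomic R ℂ).eval (lam F₀ F₁ Zp l j)‖ := by
    intro j hj
    have := core_ind (R := R) (by omega) (fun t => a (l * t) j * h t j) (lam F₀ F₁ Zp l j) ?_ R
      dvd_rfl hR
    · simpa only [hlR] using this
    intro r hr s hs
    have hrpos : 1 ≤ r := Nat.pos_of_dvd_of_pos hr (by omega)
    have hspos : 1 ≤ s := Nat.pos_of_dvd_of_pos hs hrpos
    have e1 := local_lemma hd h₀ h₁ hcz hfst hdyn (hdv r hr) hs hj
    have e2 := prod_split_JJ hl hrpos hs (fun k => a k j)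
    have e3 : (∏ t ∈ r.divisors \ s.divisors, h t j) * K s j = K r j := by
      rw [← hh r hrpos j, ← hh s hspos j, Finset.prod_sdiff]
      exact Nat.divisors_subset_of_dvd (by omega) hs
    have hKs := hKr s (hs.trans hr) j hj
    have hKr' := hKr r hr j hj
    have hKs0 := hK0 s hspos j
    rw [Finset.prod_mul_distrib]
    refine mul_right_cancel₀ hKs0 ?_
    rw [mul_assoc, e3, hKs, hKr']
    change (∏ k ∈ (l * r).divisors \ (l * s).divisors, a k j) * γ j ^ (d ^ (l * s) - 1) =
      γ j ^ (d ^ (l * r) - 1) * _ at e1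
    have g1 := pow_ne_zero (d ^ (l * r) - 1) (hγ0 j)
    have g2 := pow_ne_zero (d ^ (l * s) - 1) (hγ0 j)
    field_simp
    linear_combination (-γ j ^ (d ^ (l * s) - 1)) * e2 + (∏ k ∈ JJ l s, a k j) * e1
  have := Finset.prod_congr rfl key
  rw [Finset.prod_mul_distrib, hh1 R (by omega), mul_one] at this
  exact this

end Final


/-- Assume `|Res F| = 1` and fix dynatomic data for `n`.  Then for every
divisor `ℓ` of `n` with `ℓ < n`:
`∏_{i=1}^{d_n} ∏_{j=1}^{d_ℓ} |Z^{(n)}_i ∧ Z^{(ℓ)}_j| = ∏_{j=1}^{d_ℓ} |C_{n/ℓ}(λ^{(ℓ)}_j)|`,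
i.e. `|Res(Φ^{**}_{F,n}, Φ^{**}_{F,ℓ})| = |Δ_{n,ℓ}|^ℓ` in the normalization `|Res F| = 1`. -/
theorem stmt13 (d : ℕ) (hd : 2 ≤ d) (F₀ F₁ : MvPolynomial (Fin 2) ℂ)
    (h₀ : F₀.IsHomogeneous d) (h₁ : F₁.IsHomogeneous d)
    (hcz : ∀ Z : ℂ × ℂ, ev F₀ Z = 0 → ev F₁ Z = 0 → Z = 0)
    (A : Fin d → ℂ × ℂ) (hA : ∀ i, A i ≠ 0)
    (hfac : ∀ Z : ℂ × ℂ, ev F₀ Z = ∏ i, wedge Z (A i))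
    (hres : ∏ i, ‖ev F₁ (A i)‖ = 1)
    (n : ℕ) (hn : 1 ≤ n)
    (Zp : ℕ → ℕ → ℂ × ℂ)
    (hfst : ∀ m ∈ n.divisors, ∀ j ∈ Finset.range (dyndeg d m).toNat, (Zp m j).1 ≠ 0)
    (hdyn : ∀ m ∈ n.divisors, ∀ Z : ℂ × ℂ,
      wedge ((Fmap F₀ F₁)^[m] Z) Z =
        ∏ k ∈ m.divisors, ∏ j ∈ Finset.range (dyndeg d k).toNat, wedge Z (Zp k j))
    (hden : ∀ m ∈ n.divisors, ∀ j ∈ Finset.range (dyndeg d m).toNat,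
      ((Fmap F₀ F₁)^[m] (1, zc Zp m j)).1 ≠ 0)
    (ℓ : ℕ) (hℓ : ℓ ∣ n) (hℓn : ℓ < n) :
    ∏ i ∈ Finset.range (dyndeg d n).toNat, ∏ j ∈ Finset.range (dyndeg d ℓ).toNat,
        ‖wedge (Zp n i) (Zp ℓ j)‖ =
      ∏ j ∈ Finset.range (dyndeg d ℓ).toNat,
        ‖Polynomial.eval (lam F₀ F₁ Zp ℓ j) (Polynomial.cyclotomic (n / ℓ) ℂ)‖ := by
  have hF := good_base hd h₀ h₁ A hfac hres
  obtain ⟨R, rfl⟩ := hℓ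
  have hℓ0 : 0 < ℓ := Nat.pos_of_ne_zero (by rintro rfl; simp at hn)
  have hR : 1 < R := by
    by_contra hle
    have : R ≤ 1 := by omega
    have := Nat.mul_le_mul_left ℓ this
    omega
  have h := final_aux (D := fun k => (dyndeg d k).toNat) hd h₀ h₁ hcz hF hn hfst hdyn hR rfl
  rw [Nat.mul_div_cancel_left _ hℓ0, ← h, Finset.prod_comm]
  refine Finset.prod_congr rfl fun j _ => ?_
  rw [norm_prod]
  exact Finset.prod_congr rfl fun i _ => norm_wedge_comm _ _
end
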